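/- arXiv:1402.3006 — 8 statements merged into one kernel-verified Lean document; each statement's English description precedes it below -/
import Mathlib

section
/- Let a : [-1,1] × [0,∞) → [0,∞) be continuous and let F ∈ 𝔉 be, in addition, strictly increasing with respect to the second argument. If the inequality I(a,u*) ≤ I(a,u) holds for every nonnegative piecewise linear function u on [-1,1], then a is even with respect to the first argument, i.e. a(x,v) = a(-x,v) for all x ∈ [-1,1] and all v ≥ 0. -/
open MeasureTheory Set Filter
open scoped ENNReal BigOperators NNReal

noncomputable section

/-- `u ∈ W¹₁(-1,1)`: `u` is absolutely continuous on `[-1,1]` with (a.e.) derivative in `L¹`,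
encoded via the fundamental theorem of calculus with the pointwise derivative `deriv u`. -/
def MemW11 (u : ℝ → ℝ) : Prop :=
  IntegrableOn (deriv u) (Icc (-1 : ℝ) 1) volume ∧
  ∀ x ∈ Icc (-1 : ℝ) 1, u x = u (-1) + ∫ t in (-1 : ℝ)..x, deriv u t

/-- Convergence `u_k → u` in `W¹₁(-1,1)`. -/
def W11Tendsto (uk : ℕ → ℝ → ℝ) (u : ℝ → ℝ) : Prop :=
  Tendsto (fun k => ∫ x in Icc (-1 : ℝ) 1, (|uk k x - u x| + |deriv (uk k) x - deriv u x|))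
    atTop (nhds 0)

/-- `F ∈ 𝔉`: continuous, nonnegative, convex and nondecreasing in the second argument. -/
def MemFrakF (F : ℝ → ℝ → ℝ) : Prop :=
  ContinuousOn (fun p : ℝ × ℝ => F p.1 p.2) (Ici (0 : ℝ) ×ˢ Ici (0 : ℝ)) ∧
  (∀ v p : ℝ, 0 ≤ v → 0 ≤ p → 0 ≤ F v p) ∧
  (∀ v : ℝ, 0 ≤ v → ConvexOn ℝ (Ici (0 : ℝ)) (F v)) ∧
  (∀ v : ℝ, 0 ≤ v → MonotoneOn (F v) (Ici (0 : ℝ)))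

/-- A continuous nonnegative weight on `[-1,1] × [0,∞)`. -/
def Weight (a : ℝ → ℝ → ℝ) : Prop :=
  ContinuousOn (fun p : ℝ × ℝ => a p.1 p.2) (Icc (-1 : ℝ) 1 ×ˢ Ici (0 : ℝ)) ∧
  ∀ x v : ℝ, x ∈ Icc (-1 : ℝ) 1 → 0 ≤ v → 0 ≤ a x v

/-- Condition (C): `a(s,v) + a(t,v) ≥ a(1 - t + s, v)` for `-1 ≤ s ≤ t ≤ 1`, `v ≥ 0`. -/
def CondC (a : ℝ → ℝ → ℝ) : Prop :=
  ∀ s t v : ℝ, -1 ≤ s → s ≤ t → t ≤ 1 → 0 ≤ v → a (1 - t + s) v ≤ a s v + a t v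

/-- Condition (C) for a one-variable weight. -/
def CondC1 (a : ℝ → ℝ) : Prop :=
  ∀ s t : ℝ, -1 ≤ s → s ≤ t → t ≤ 1 → a (1 - t + s) ≤ a s + a t

/-- Condition (C'): `a(s,v) + a(t,v) ≥ a((s-t)/2, v) + a((t-s)/2, v)`. -/
def CondC' (a : ℝ → ℝ → ℝ) : Prop :=
  ∀ s t v : ℝ, s ∈ Icc (-1 : ℝ) 1 → t ∈ Icc (-1 : ℝ) 1 → 0 ≤ v →
    a ((s - t) / 2) v + a ((t - s) / 2) v ≤ a s v + a t v

/-- The functional `I(a,u) = ∫_{-1}^1 F(u(x), a(x,u(x))·|u'(x)|) dx ∈ [0,∞]`. -/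
def Ifun (F a : ℝ → ℝ → ℝ) (u : ℝ → ℝ) : ℝ≥0∞ :=
  ∫⁻ x in Icc (-1 : ℝ) 1, ENNReal.ofReal (F (u x) (a x (u x) * |deriv u x|))

/-- The monotone rearrangement `u*(x) = ∫₀^∞ χ_{[1-|A_t|,1]}(x) dt`,
where `A_t = {y ∈ [-1,1] : u(y) > t}`. -/
def mrear (u : ℝ → ℝ) (x : ℝ) : ℝ :=
  ∫ t in Ioi (0 : ℝ),
    (Icc (1 - (volume {y ∈ Icc (-1 : ℝ) 1 | u y > t}).toReal) 1).indicator
      (fun _ => (1 : ℝ)) x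

/-- The symmetric rearrangement `ū(x) = ∫₀^∞ χ_{[-|A_t|/2, |A_t|/2]}(x) dt`. -/
def srear (u : ℝ → ℝ) (x : ℝ) : ℝ :=
  ∫ t in Ioi (0 : ℝ),
    (Icc (-((volume {y ∈ Icc (-1 : ℝ) 1 | u y > t}).toReal / 2))
        ((volume {y ∈ Icc (-1 : ℝ) 1 | u y > t}).toReal / 2)).indicator
      (fun _ => (1 : ℝ)) x

/-- `u` is piecewise linear on `[-1,1]`: there is a partition `-1 = x₀ < ⋯ < x_n = 1`
such that `u` is affine on each `[x_i, x_{i+1}]`. -/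
def PiecewiseLinear (u : ℝ → ℝ) : Prop :=
  ∃ n : ℕ, ∃ x : Fin (n + 1) → ℝ, x 0 = -1 ∧ x (Fin.last n) = 1 ∧ StrictMono x ∧
    ∀ i : Fin n, ∃ c d : ℝ, ∀ y ∈ Icc (x i.castSucc) (x i.succ), u y = c * y + d

/-- For a continuous nonincreasing function, the monotone rearrangement is the reflection. -/
lemma mrear_of_antitone {u : ℝ → ℝ} (hc : Continuous u) (hu : Antitone u) (h0 : ∀ y, 0 ≤ u y)
    {x : ℝ} (hx : x ∈ Ioo (-1 : ℝ) 1) : mrear u x = u (-x) := by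
  have fin : ∀ t, volume {y ∈ Icc (-1 : ℝ) 1 | u y > t} ≠ ∞ := fun t =>
    ((measure_mono (fun y hy => hy.1)).trans_lt
      (measure_Icc_lt_top (μ := volume) (a := (-1 : ℝ)) (b := 1))).ne
  have below : ∀ t, t < u (-x) →
      1 - (volume {y ∈ Icc (-1 : ℝ) 1 | u y > t}).toReal ≤ x := by
    intro t ht
    have hsub : Icc (-1 : ℝ) (-x) ⊆ {y ∈ Icc (-1 : ℝ) 1 | u y > t} := fun y hy =>
      ⟨⟨hy.1, by linarith [hy.2, hx.1]⟩, ht.trans_le (hu hy.2)⟩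
    have h := ENNReal.toReal_mono (fin t) (measure_mono (μ := volume) hsub)
    rw [Real.volume_Icc, ENNReal.toReal_ofReal (by linarith [hx.2])] at h
    linarith
  have above : ∀ t, u (-x) < t →
      x < 1 - (volume {y ∈ Icc (-1 : ℝ) 1 | u y > t}).toReal := by
    intro t ht
    have hev : ∀ᶠ z in nhdsWithin (-x) (Iio (-x)), u z < t :=
      (hc.continuousAt.eventually_lt continuousAt_const ht).filter_mono nhdsWithin_le_nhds
    have hev' : ∀ᶠ z in nhdsWithin (-x) (Iio (-x)), z ∈ Ioo (-1) (-x) :=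
      Ioo_mem_nhdsLT (by linarith [hx.2])
    obtain ⟨z, hz, hzx⟩ := (hev.and hev').exists
    have hsub : {y ∈ Icc (-1 : ℝ) 1 | u y > t} ⊆ Icc (-1 : ℝ) z := by
      rintro y ⟨hy, hyt⟩
      refine ⟨hy.1, le_of_not_gt fun hzy => ?_⟩
      exact absurd (hu hzy.le) (not_le.2 (hz.trans hyt))
    have h := ENNReal.toReal_mono (measure_Icc_lt_top (μ := volume)).ne
      (measure_mono (μ := volume) hsub)
    rw [Real.volume_Icc, ENNReal.toReal_ofReal (by linarith [hzx.1])] at h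
    linarith [hzx.2]
  have key : mrear u x = ∫ t in Ioi (0 : ℝ), (Iio (u (-x))).indicator (fun _ => (1 : ℝ)) t := by
    refine integral_congr_ae (ae_restrict_of_ae ?_)
    filter_upwards [compl_mem_ae_iff.2 (measure_singleton (μ := volume) (u (-x)))] with t ht
    rcases lt_or_gt_of_ne ht with h | h
    · rw [indicator_of_mem (show x ∈ Icc _ 1 from ⟨below t h, hx.2.le⟩),
        indicator_of_mem (show t ∈ Iio _ from h)]
    · rw [indicator_of_notMem (fun hm => absurd hm.1 (not_le.2 (above t h))),
        indicator_of_notMem (show t ∉ Iio (u (-x)) from not_lt.2 h.le)]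
  rw [key, setIntegral_indicator measurableSet_Iio, Ioi_inter_Iio, setIntegral_const]
  simp [h0]

/-- The functional of the monotone rearrangement of a nonincreasing function, as an integral
of the function itself with the reflected weight. -/
lemma Ifun_mrear_of_antitone (F a : ℝ → ℝ → ℝ) {u : ℝ → ℝ} (hc : Continuous u)
    (hu : Antitone u) (h0 : ∀ y, 0 ≤ u y) :
    Ifun F a (mrear u) =
      ∫⁻ y in Ioo (-1 : ℝ) 1, ENNReal.ofReal (F (u y) (a (-y) (u y) * |deriv u y|)) := by
  have h1 : Ifun F a (mrear u) = ∫⁻ y in Ioo (-1 : ℝ) 1,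
      ENNReal.ofReal (F (u (-y)) (a (- -y) (u (-y)) * |deriv u (-y)|)) := by
    rw [Ifun, setLIntegral_congr Ioo_ae_eq_Icc.symm]
    refine setLIntegral_congr_fun measurableSet_Ioo fun y hy => ?_
    have hd : deriv (mrear u) y = - deriv u (-y) := by
      rw [← deriv_comp_neg]
      refine Filter.EventuallyEq.deriv_eq ?_
      filter_upwards [isOpen_Ioo.mem_nhds hy] with z hz
      exact mrear_of_antitone hc hu h0 hz
    simp only [hd, mrear_of_antitone hc hu h0 hy, abs_neg, neg_neg]
  have hpre : (Neg.neg : ℝ → ℝ) ⁻¹' Ioo (-1 : ℝ) 1 = Ioo (-1) 1 := by simp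
  rw [h1, ← (Measure.measurePreserving_neg (volume : Measure ℝ)).setLIntegral_comp_preimage_emb
    (MeasurableEquiv.neg ℝ).measurableEmbedding _ (Ioo (-1 : ℝ) 1), hpre]
  simp only [neg_neg]

/-- The decreasing ramp from `v + d` to `v` with slope `-1` on `[p, p + d]`. -/
def ramp (p d v y : ℝ) : ℝ := v + max 0 (min d (p + d - y))

lemma continuous_ramp (p d v : ℝ) : Continuous (ramp p d v) := by
  unfold ramp; fun_prop

lemma antitone_ramp (p d v : ℝ) : Antitone (ramp p d v) := by
  intro y z h
  unfold ramp
  gcongr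

lemma le_ramp (p d v y : ℝ) : v ≤ ramp p d v y := by
  simp [ramp]

lemma ramp_of_le {p d y : ℝ} (v : ℝ) (hd : 0 ≤ d) (hy : y ≤ p) : ramp p d v y = v + d := by
  rw [ramp, min_eq_left (by linarith), max_eq_right hd]

lemma ramp_of_ge {p d y : ℝ} (v : ℝ) (hy : p + d ≤ y) : ramp p d v y = v := by
  rw [ramp, max_eq_left ((min_le_right _ _).trans (by linarith)), add_zero]

lemma ramp_of_mem {p d y : ℝ} (v : ℝ) (hy : y ∈ Icc p (p + d)) :
    ramp p d v y = v + (p + d - y) := by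
  rw [ramp, min_eq_right (by linarith [hy.1]), max_eq_right (by linarith [hy.2])]

lemma deriv_ramp_of_lt {p d y : ℝ} (v : ℝ) (hd : 0 ≤ d) (hy : y < p) :
    deriv (ramp p d v) y = 0 := by
  have : ramp p d v =ᶠ[nhds y] fun _ => v + d := by
    filter_upwards [Iio_mem_nhds hy] with z hz using ramp_of_le v hd (le_of_lt hz)
  rw [this.deriv_eq, deriv_const]

lemma deriv_ramp_of_gt {p d y : ℝ} (v : ℝ) (hy : p + d < y) :
    deriv (ramp p d v) y = 0 := by
  have : ramp p d v =ᶠ[nhds y] fun _ => v := by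
    filter_upwards [Ioi_mem_nhds hy] with z hz using ramp_of_ge v (le_of_lt hz)
  rw [this.deriv_eq, deriv_const]

lemma deriv_ramp_of_mem {p d y : ℝ} (v : ℝ) (hy : y ∈ Ioo p (p + d)) :
    deriv (ramp p d v) y = -1 := by
  have : ramp p d v =ᶠ[nhds y] fun z => v + (p + d - z) := by
    filter_upwards [isOpen_Ioo.mem_nhds hy] with z hz
    exact ramp_of_mem v (Ioo_subset_Icc_self hz)
  rw [this.deriv_eq]
  simp

lemma piecewiseLinear_ramp {p d : ℝ} (v : ℝ) (hp : -1 < p) (hd : 0 < d) (hpd : p + d < 1) :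
    PiecewiseLinear (ramp p d v) := by
  refine ⟨3, ![-1, p, p + d, 1], rfl, rfl, ?_, ?_⟩
  · rw [Fin.strictMono_iff_lt_succ]
    intro i
    fin_cases i
    · exact hp
    · exact lt_add_of_pos_right p hd
    · exact hpd
  · intro i
    fin_cases i
    · refine ⟨0, v + d, fun y hy => ?_⟩
      rw [ramp_of_le v hd.le (show y ≤ p from hy.2)]; ring
    · refine ⟨-1, v + (p + d), fun y hy => ?_⟩
      rw [ramp_of_mem v (show y ∈ Icc p (p + d) from hy)]; ring
    · refine ⟨0, v, fun y hy => ?_⟩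
      rw [ramp_of_ge v (show p + d ≤ y from hy.1)]; ring

/-- A weight composed with the retraction of `ℝ × ℝ` onto `[-1,1] × [0,∞)` is continuous. -/
lemma Weight.continuous_extend {a : ℝ → ℝ → ℝ} (ha : Weight a) :
    Continuous fun p : ℝ × ℝ => a (max (-1) (min 1 p.1)) (max 0 p.2) := by
  refine ha.1.comp_continuous
    (f := fun p : ℝ × ℝ => ((max (-1) (min 1 p.1), max 0 p.2) : ℝ × ℝ)) (by fun_prop) ?_
  exact fun p => ⟨⟨le_max_left _ _, max_le (by norm_num) (min_le_left _ _)⟩, mem_Ici.2 (le_max_left _ _)⟩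

/-- An integrand in `𝔉` composed with the retraction of `ℝ × ℝ` onto the closed quadrant is
continuous. -/
lemma MemFrakF.continuous_extend {F : ℝ → ℝ → ℝ} (hF : MemFrakF F) :
    Continuous fun p : ℝ × ℝ => F (max 0 p.1) (max 0 p.2) :=
  hF.1.comp_continuous (f := fun p : ℝ × ℝ => ((max 0 p.1, max 0 p.2) : ℝ × ℝ)) (by fun_prop)
    fun _ => ⟨mem_Ici.2 (le_max_left _ _), mem_Ici.2 (le_max_left _ _)⟩

/-- For continuous `u ≥ 0`, the integrand, as a function of the point and the slope, agrees on
`[-1,1] × [0,∞)` with a function continuous on the whole plane. -/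
lemma exists_continuous_integrand {a F : ℝ → ℝ → ℝ} (ha : Weight a) (hF : MemFrakF F)
    {u : ℝ → ℝ} (hc : Continuous u) (h0 : ∀ y, 0 ≤ u y) {r : ℝ → ℝ} (hr : Continuous r)
    (hrm : ∀ y ∈ Icc (-1 : ℝ) 1, r y ∈ Icc (-1 : ℝ) 1) :
    ∃ G : ℝ × ℝ → ℝ, Continuous G ∧ ∀ y ∈ Icc (-1 : ℝ) 1, ∀ s, 0 ≤ s →
      G (y, s) = F (u y) (a (r y) (u y) * s) := by
  refine ⟨fun q => F (max 0 (u q.1))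
    (max 0 (a (max (-1) (min 1 (r q.1))) (max 0 (u q.1)) * q.2)), ?_, ?_⟩
  · have h1 : Continuous fun q : ℝ × ℝ => a (max (-1) (min 1 (r q.1))) (max 0 (u q.1)) :=
      ha.continuous_extend.comp (f := fun q : ℝ × ℝ => ((r q.1, u q.1) : ℝ × ℝ)) (by fun_prop)
    exact hF.continuous_extend.comp (f := fun q : ℝ × ℝ =>
      ((u q.1, a (max (-1) (min 1 (r q.1))) (max 0 (u q.1)) * q.2) : ℝ × ℝ))
      ((hc.comp continuous_fst).prodMk (h1.mul continuous_snd))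
  · intro y hy s hs
    have hy' := hrm y hy
    simp only
    rw [max_eq_right (h0 y), min_eq_right hy'.2, max_eq_right hy'.1,
      max_eq_right (mul_nonneg (ha.2 _ _ hy' (h0 y)) hs)]

lemma weight_neg_le {a F : ℝ → ℝ → ℝ} (ha : Weight a) (hF : MemFrakF F)
    (hFstrict : ∀ v : ℝ, 0 ≤ v → StrictMonoOn (F v) (Ici (0 : ℝ)))
    (H : ∀ u : ℝ → ℝ, PiecewiseLinear u → (∀ x ∈ Icc (-1 : ℝ) 1, 0 ≤ u x) →
      Ifun F a (mrear u) ≤ Ifun F a u)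
    {x v : ℝ} (hx : x ∈ Ioo (-1 : ℝ) 1) (hv : 0 ≤ v) : a (-x) v ≤ a x v := by
  by_contra! hlt
  obtain ⟨d, hd, hxd, hda⟩ : ∃ d > 0, x + d < 1 ∧
      ∀ y ∈ Ioo x (x + d), ∀ w ∈ Icc v (v + d), a y w < a (-y) w := by
    have hcl := ha.continuous_extend
    have hcr := hcl.comp (f := fun q : ℝ × ℝ => ((-q.1, q.2) : ℝ × ℝ)) (by fun_prop)
    have hev : ∀ᶠ q : ℝ × ℝ in nhds (x, v), a (max (-1) (min 1 q.1)) (max 0 q.2) <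
        a (max (-1) (min 1 (-q.1))) (max 0 q.2) := by
      refine hcl.continuousAt.eventually_lt hcr.continuousAt ?_
      simp only
      rwa [min_eq_right hx.2.le, max_eq_right hx.1.le, max_eq_right hv,
        min_eq_right (by linarith [hx.1]), max_eq_right (by linarith [hx.2])]
    obtain ⟨ε, hε, hball⟩ := Metric.eventually_nhds_iff.1 hev
    have hm : 0 < min (ε / 2) ((1 - x) / 2) := lt_min (by linarith) (by linarith [hx.2])
    have hm1 := min_le_left (ε / 2) ((1 - x) / 2)
    have hm2 := min_le_right (ε / 2) ((1 - x) / 2)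
    refine ⟨min (ε / 2) ((1 - x) / 2), hm, by linarith [hx.2], fun y hy w hw => ?_⟩
    have hdist : dist ((y, w) : ℝ × ℝ) (x, v) < ε := by
      rw [Prod.dist_eq, max_lt_iff, Real.dist_eq, Real.dist_eq, abs_lt, abs_lt]
      refine ⟨⟨?_, ?_⟩, ?_, ?_⟩ <;> linarith [hy.1, hy.2, hw.1, hw.2]
    have h := hball hdist
    simp only at h
    rwa [min_eq_right (by linarith [hy.2, hx.2]), max_eq_right (by linarith [hy.1, hx.1]),
      max_eq_right (hv.trans hw.1), min_eq_right (by linarith [hy.1, hx.1]),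
      max_eq_right (by linarith [hy.2, hx.2])] at h
  set u := ramp x d v with hu
  have huc : Continuous u := continuous_ramp x d v
  have hu0 : ∀ y, 0 ≤ u y := fun y => hv.trans (le_ramp x d v y)
  have hI := H u (piecewiseLinear_ramp v hx.1 hd hxd) fun y _ => hu0 y
  rw [Ifun_mrear_of_antitone F a huc (antitone_ramp x d v) hu0, Ifun,
    setLIntegral_congr (Ioo_ae_eq_Icc (a := (-1 : ℝ)) (b := 1)).symm] at hI
  obtain ⟨G, hGc, hG⟩ := exists_continuous_integrand ha hF huc hu0 continuous_id fun y hy => hy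
  obtain ⟨K, hKc, hK⟩ := exists_continuous_integrand ha hF huc hu0 continuous_neg
    fun y hy => ⟨by linarith [hy.2], by linarith [hy.1]⟩
  have hcases : ∀ᵐ y : ℝ, deriv u y = 0 ∨ (y ∈ Ioo x (x + d) ∧ deriv u y = -1) := by
    filter_upwards [compl_mem_ae_iff.2 (measure_singleton (μ := volume) x),
      compl_mem_ae_iff.2 (measure_singleton (μ := volume) (x + d))] with y h1 h2
    rcases lt_or_gt_of_ne h1 with h1 | h1
    · exact .inl (deriv_ramp_of_lt v hd.le h1)
    rcases lt_or_gt_of_ne h2 with h2 | h2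
    · exact .inr ⟨⟨h1, h2⟩, deriv_ramp_of_mem v ⟨h1, h2⟩⟩
    · exact .inl (deriv_ramp_of_gt v h2)
  have hstrict : ∀ y ∈ Ioo x (x + d), deriv u y = -1 →
      ENNReal.ofReal (F (u y) (a y (u y) * |deriv u y|)) <
        ENNReal.ofReal (F (u y) (a (-y) (u y) * |deriv u y|)) := by
    intro y hy hdy
    have hay : 0 ≤ a y (u y) :=
      ha.2 _ _ ⟨by linarith [hy.1, hx.1], by linarith [hy.2]⟩ (hu0 y)
    have hlt' : a y (u y) < a (-y) (u y) := by
      refine hda y hy _ ⟨le_ramp x d v y, ?_⟩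
      rw [hu, ramp_of_mem v (Ioo_subset_Icc_self hy)]
      linarith [hy.1]
    have hFlt := hFstrict (u y) (hu0 y) hay (hay.trans hlt'.le) hlt'
    simp only [hdy, abs_neg, abs_one, mul_one]
    exact (ENNReal.ofReal_lt_ofReal_iff
      ((hF.2.1 _ _ (hu0 y) hay).trans_lt hFlt)).2 hFlt
  have hfin : ∫⁻ y in Ioo (-1 : ℝ) 1,
      ENNReal.ofReal (F (u y) (a y (u y) * |deriv u y|)) ≠ ∞ := by
    obtain ⟨C, hC⟩ := (isCompact_Icc.prod isCompact_Icc :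
      IsCompact (Icc (-1 : ℝ) 1 ×ˢ Icc (0 : ℝ) 1)).bddAbove_image hGc.continuousOn
    refine ((setLIntegral_mono_ae (g := fun _ => ENNReal.ofReal C) measurable_const.aemeasurable
      ?_).trans_lt ?_).ne
    · filter_upwards [hcases] with y hy hym
      have hym := Ioo_subset_Icc_self hym
      have hs : |deriv u y| ≤ 1 := by
        rcases hy with h | ⟨-, h⟩ <;> simp [h]
      refine ENNReal.ofReal_le_ofReal ?_
      have h := hG y hym _ (abs_nonneg (deriv u y))
      simp only [id] at h
      rw [← h]
      exact hC ⟨_, ⟨hym, abs_nonneg _, hs⟩, rfl⟩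
    · rw [setLIntegral_const]
      exact ENNReal.mul_lt_top ENNReal.ofReal_lt_top measure_Ioo_lt_top
  have hmeas : AEMeasurable (fun y => ENNReal.ofReal (F (u y) (a (-y) (u y) * |deriv u y|)))
      (volume.restrict (Ioo (-1 : ℝ) 1)) := by
    have hm : Measurable fun y => ENNReal.ofReal (K (y, |deriv u y|)) :=
      (hKc.measurable.comp (measurable_id.prodMk
        (continuous_abs.measurable.comp (measurable_deriv u)))).ennreal_ofReal
    refine hm.aemeasurable.congr ?_
    filter_upwards [ae_restrict_mem measurableSet_Ioo] with y hy
    rw [hK y (Ioo_subset_Icc_self hy) _ (abs_nonneg _)]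
  refine absurd hI (not_le.2 (lintegral_strict_mono_of_ae_le_of_ae_lt_on hmeas hfin ?_
    (s := Ioo x (x + d)) ?_ ?_))
  · filter_upwards [ae_restrict_of_ae hcases] with y hy
    rcases hy with h | ⟨hy, h⟩
    · simp [h]
    · exact (hstrict y hy h).le
  · rw [Measure.restrict_apply measurableSet_Ioo, inter_eq_left.2
      (Ioo_subset_Ioo hx.1.le hxd.le), Real.volume_Ioo]
    simpa using hd
  · exact .of_forall fun y hy => hstrict y hy (deriv_ramp_of_mem v hy)

/-- if `I(a,u*) ≤ I(a,u)` for all nonnegative piecewise linear `u`, for some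
`F ∈ 𝔉` strictly increasing in its second argument, then `a` is even in `x`. -/
theorem stmt0 (a F : ℝ → ℝ → ℝ) (ha : Weight a) (hF : MemFrakF F)
    (hFstrict : ∀ v : ℝ, 0 ≤ v → StrictMonoOn (F v) (Ici (0 : ℝ)))
    (H : ∀ u : ℝ → ℝ, PiecewiseLinear u → (∀ x ∈ Icc (-1 : ℝ) 1, 0 ≤ u x) →
      Ifun F a (mrear u) ≤ Ifun F a u) :
    ∀ x ∈ Icc (-1 : ℝ) 1, ∀ v : ℝ, 0 ≤ v → a x v = a (-x) v := by
  intro x hx v hv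
  have hmem : ∀ y ∈ Icc (-1 : ℝ) 1, -y ∈ Icc (-1 : ℝ) 1 := fun y hy =>
    ⟨by linarith [hy.2], by linarith [hy.1]⟩
  have hmem' : ∀ y ∈ Ioo (-1 : ℝ) 1, -y ∈ Ioo (-1 : ℝ) 1 := fun y hy =>
    ⟨by linarith [hy.2], by linarith [hy.1]⟩
  have hc : ContinuousOn (fun y => a y v) (Icc (-1 : ℝ) 1) :=
    ha.1.comp (f := fun y : ℝ => ((y, v) : ℝ × ℝ)) (by fun_prop) fun y hy => ⟨hy, hv⟩
  have hc' : ContinuousOn (fun y => a (-y) v) (Icc (-1 : ℝ) 1) :=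
    hc.comp (f := fun y : ℝ => -y) continuous_neg.continuousOn hmem
  have heq : EqOn (fun y => a y v) (fun y => a (-y) v) (Ioo (-1 : ℝ) 1) := fun y hy => by
    refine le_antisymm ?_ (weight_neg_le ha hF hFstrict H hy hv)
    simpa using weight_neg_le ha hF hFstrict H (hmem' y hy) hv
  exact heq.of_subset_closure hc hc' Ioo_subset_Icc_self
    (by rw [closure_Ioo (by norm_num)]) hx
end
end

section
/- Let a : [-1,1] × [0,∞) → [0,∞) be continuous. If for every F ∈ 𝔉 the inequality I(a,u*) ≤ I(a,u) holds for every nonnegative piecewise linear function u on [-1,1], then a satisfies condition (C), i.e. a(s,v) + a(t,v) ≥ a(1 - t + s, v) for all -1 ≤ s ≤ t ≤ 1 and all v ≥ 0. -/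
open MeasureTheory Set Filter
open scoped ENNReal BigOperators NNReal

noncomputable section

/-- The trapezoidal bump of height `ε` over `[s, t]` with slopes `±1`, raised by `v`. -/
def bump (s t v ε : ℝ) (x : ℝ) : ℝ := v + max 0 (min ε (min (x - s) (t - x)))

theorem memFrakF_snd : MemFrakF (fun _ p => p) :=
  ⟨continuous_snd.continuousOn, fun _ _ _ hp => hp, fun _ _ => convexOn_id (convex_Ici 0),
    fun _ _ => monotoneOn_id⟩

theorem le_bump (s t v ε x : ℝ) : v ≤ bump s t v ε x := by
  unfold bump
  linarith [le_max_left 0 (min ε (min (x - s) (t - x)))]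

theorem bump_le (s t v x : ℝ) {ε : ℝ} (hε : 0 < ε) : bump s t v ε x ≤ v + ε := by
  unfold bump
  linarith [max_le hε.le (min_le_left ε (min (x - s) (t - x)))]

theorem bump_of_le_left {s t v ε x : ℝ} (h : x ≤ s) : bump s t v ε x = v := by
  unfold bump
  rw [max_eq_left, add_zero]
  exact (min_le_right _ _).trans ((min_le_left _ _).trans (by linarith))

theorem bump_of_ge_right {s t v ε x : ℝ} (h : t ≤ x) : bump s t v ε x = v := by
  unfold bump
  rw [max_eq_left, add_zero]
  exact (min_le_right _ _).trans ((min_le_right _ _).trans (by linarith))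

theorem bump_of_mem_plateau {s t v ε x : ℝ} (hε : 0 < ε) (h₁ : s + ε ≤ x) (h₂ : x ≤ t - ε) :
    bump s t v ε x = v + ε := by
  unfold bump
  rw [min_eq_left (le_min (by linarith) (by linarith)), max_eq_right hε.le]

theorem lipschitzWith_bump (s t v ε : ℝ) : LipschitzWith 1 (bump s t v ε) := by
  have h₁ : LipschitzWith 1 (fun x : ℝ => x - s) :=
    LipschitzWith.of_dist_le_mul fun x y => by simp
  have h₂ : LipschitzWith 1 (fun x : ℝ => t - x) :=
    LipschitzWith.of_dist_le_mul fun x y => by rw [dist_sub_left, NNReal.coe_one, one_mul]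
  have h₃ := ((h₁.min h₂).const_min ε).const_max 0
  simp only [max_self] at h₃
  refine LipschitzWith.of_dist_le_mul fun x y => ?_
  simpa [bump] using h₃.dist_le_mul x y

theorem piecewiseLinear_bump {s t v ε : ℝ} (hs : -1 < s) (ht : t < 1) (hε : 0 < ε)
    (hst : 2 * ε < t - s) : PiecewiseLinear (bump s t v ε) := by
  refine ⟨5, ![-1, s, s + ε, t - ε, t, 1], rfl, rfl, ?_, ?_⟩
  · rw [Fin.strictMono_iff_lt_succ]
    intro i
    fin_cases i <;> simp <;> linarith
  · intro i
    fin_cases i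
    · refine ⟨0, v, fun y hy => ?_⟩
      have : y ≤ s := hy.2
      rw [bump_of_le_left this]; ring
    · refine ⟨1, v - s, fun y hy => ?_⟩
      have h₁ : s ≤ y := hy.1
      have h₂ : y ≤ s + ε := hy.2
      unfold bump
      rw [min_eq_left (a := y - s) (by linarith), min_eq_right (by linarith),
        max_eq_right (by linarith)]
      ring
    · refine ⟨0, v + ε, fun y hy => ?_⟩
      have h₁ : s + ε ≤ y := hy.1
      have h₂ : y ≤ t - ε := hy.2
      rw [bump_of_mem_plateau hε h₁ h₂]; ring
    · refine ⟨-1, v + t, fun y hy => ?_⟩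
      have h₁ : t - ε ≤ y := hy.1
      have h₂ : y ≤ t := hy.2
      unfold bump
      rw [min_eq_right (b := t - y) (by linarith), min_eq_right (by linarith),
        max_eq_right (by linarith)]
      ring
    · refine ⟨0, v, fun y hy => ?_⟩
      have : t ≤ y := hy.1
      rw [bump_of_ge_right this]; ring

theorem deriv_bump_eq_zero {s t v ε x : ℝ} (hε : 0 < ε) (h₁ : x ∉ Icc s (s + ε))
    (h₂ : x ∉ Icc (t - ε) t) : deriv (bump s t v ε) x = 0 := by
  have key : ∃ c, bump s t v ε =ᶠ[nhds x] fun _ => c := by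
    rcases lt_or_ge x s with h | h
    · refine ⟨v, ?_⟩
      filter_upwards [Iio_mem_nhds h] with y hy using bump_of_le_left (le_of_lt hy)
    rcases lt_or_ge t x with h' | h'
    · refine ⟨v, ?_⟩
      filter_upwards [Ioi_mem_nhds h'] with y hy using bump_of_ge_right (le_of_lt hy)
    have h₃ : s + ε < x := by by_contra! hc; exact h₁ ⟨h, hc⟩
    have h₄ : x < t - ε := by by_contra! hc; exact h₂ ⟨hc, h'⟩
    refine ⟨v + ε, ?_⟩
    filter_upwards [Ioo_mem_nhds h₃ h₄] with y hy
      using bump_of_mem_plateau hε hy.1.le hy.2.le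
  obtain ⟨c, hc⟩ := key
  rw [hc.deriv_eq, deriv_const]

theorem Ifun_bump_le {a : ℝ → ℝ → ℝ} (ha : Weight a) {s t v ε A B : ℝ} (hv : 0 ≤ v)
    (hε : 0 < ε) (hA : ∀ x ∈ Icc (-1 : ℝ) 1, x ∈ Icc s (s + ε) → ∀ y ∈ Icc v (v + ε), a x y ≤ A)
    (hB : ∀ x ∈ Icc (-1 : ℝ) 1, x ∈ Icc (t - ε) t → ∀ y ∈ Icc v (v + ε), a x y ≤ B) :
    Ifun (fun _ p => p) a (bump s t v ε) ≤
      ENNReal.ofReal A * ENNReal.ofReal ε + ENNReal.ofReal B * ENNReal.ofReal ε := by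
  have hd : ∀ x, |deriv (bump s t v ε) x| ≤ 1 := fun x => by
    simpa using norm_deriv_le_of_lipschitz (x₀ := x) (lipschitzWith_bump s t v ε)
  have hle : ∀ x ∈ Icc (-1 : ℝ) 1, a x (bump s t v ε x) * |deriv (bump s t v ε) x| ≤
      a x (bump s t v ε x) := fun x hx =>
    mul_le_of_le_one_right (ha.2 _ _ hx (hv.trans (le_bump ..))) (hd x)
  have hmem : ∀ x, bump s t v ε x ∈ Icc v (v + ε) := fun x => ⟨le_bump .., bump_le _ _ _ _ hε⟩
  calc Ifun (fun _ p => p) a (bump s t v ε)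
      ≤ ∫⁻ x in Icc (-1 : ℝ) 1, ((Icc s (s + ε)).indicator (fun _ => ENNReal.ofReal A) x +
          (Icc (t - ε) t).indicator (fun _ => ENNReal.ofReal B) x) := by
        refine setLIntegral_mono' measurableSet_Icc fun x hx => ?_
        by_cases h₁ : x ∈ Icc s (s + ε)
        · rw [indicator_of_mem h₁]
          exact le_add_right (ENNReal.ofReal_le_ofReal
            ((hle x hx).trans (hA x hx h₁ _ (hmem x))))
        by_cases h₂ : x ∈ Icc (t - ε) t
        · rw [indicator_of_mem h₂]
          exact le_add_left (ENNReal.ofReal_le_ofReal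
            ((hle x hx).trans (hB x hx h₂ _ (hmem x))))
        · simp [deriv_bump_eq_zero hε h₁ h₂]
    _ ≤ ∫⁻ x, ((Icc s (s + ε)).indicator (fun _ => ENNReal.ofReal A) x +
          (Icc (t - ε) t).indicator (fun _ => ENNReal.ofReal B) x) := setLIntegral_le_lintegral _ _
    _ = ENNReal.ofReal A * ENNReal.ofReal ε + ENNReal.ofReal B * ENNReal.ofReal ε := by
        rw [lintegral_add_left (measurable_const.indicator measurableSet_Icc),
          lintegral_indicator_const measurableSet_Icc, lintegral_indicator_const measurableSet_Icc]
        simp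

theorem bump_superlevel_of_lt {s t v ε τ : ℝ} (h : τ < v) :
    {y ∈ Icc (-1 : ℝ) 1 | bump s t v ε y > τ} = Icc (-1) 1 := by
  ext y
  simp only [mem_ofPred_eq, and_iff_left_iff_imp]
  exact fun _ => h.trans_le (le_bump ..)

theorem bump_superlevel_of_mem {s t v ε τ : ℝ} (hs : -1 < s) (ht : t < 1) (h₁ : v ≤ τ)
    (h₂ : τ < v + ε) :
    {y ∈ Icc (-1 : ℝ) 1 | bump s t v ε y > τ} = Ioo (s + (τ - v)) (t - (τ - v)) := by
  ext y
  have key : bump s t v ε y > τ ↔ s + (τ - v) < y ∧ y < t - (τ - v) := by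
    unfold bump
    rw [gt_iff_lt, ← sub_lt_iff_lt_add', lt_max_iff, lt_min_iff, lt_min_iff]
    constructor
    · rintro (h | ⟨-, h, h'⟩)
      · linarith
      · constructor <;> linarith
    · rintro ⟨h, h'⟩
      exact Or.inr ⟨by linarith, by linarith, by linarith⟩
  simp only [mem_ofPred_eq, key, mem_Icc, mem_Ioo, and_iff_right_iff_imp]
  rintro ⟨h, h'⟩
  constructor <;> linarith

theorem bump_superlevel_of_ge {s t v ε τ : ℝ} (hε : 0 < ε) (h : v + ε ≤ τ) :
    {y ∈ Icc (-1 : ℝ) 1 | bump s t v ε y > τ} = ∅ := by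
  ext y
  simp only [mem_ofPred_eq, mem_empty_iff_false, iff_false, not_and, not_lt, gt_iff_lt]
  exact fun _ => (bump_le _ _ _ _ hε).trans h

theorem mrear_bump {s t v ε x : ℝ} (hs : -1 < s) (ht : t < 1) (hv : 0 ≤ v) (hε : 0 < ε)
    (hst : 2 * ε < t - s) (hx : x ∈ Ioo (1 - t + s) (1 - t + s + 2 * ε)) :
    mrear (bump s t v ε) x = v + (x - (1 - t + s)) / 2 := by
  obtain ⟨hx₁, hx₂⟩ := hx
  have key : ∀ τ : ℝ,
      (Icc (1 - (volume {y ∈ Icc (-1 : ℝ) 1 | bump s t v ε y > τ}).toReal) 1).indicator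
        (fun _ => (1 : ℝ)) x =
      (Iic (v + (x - (1 - t + s)) / 2)).indicator (fun _ => (1 : ℝ)) τ := by
    intro τ
    simp only [indicator_apply]
    refine if_congr ?_ rfl rfl
    rw [mem_Icc, mem_Iic]
    rcases lt_or_ge τ v with h | h
    · rw [bump_superlevel_of_lt h, Real.volume_Icc, ENNReal.toReal_ofReal (by norm_num)]
      constructor
      · intro; linarith
      · intro; constructor <;> linarith
    rcases lt_or_ge τ (v + ε) with h' | h'
    · rw [bump_superlevel_of_mem hs ht h h', Real.volume_Ioo,
        ENNReal.toReal_ofReal (by linarith)]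
      constructor
      · rintro ⟨h₁, h₂⟩; linarith
      · intro; constructor <;> linarith
    · rw [bump_superlevel_of_ge hε h', measure_empty, ENNReal.toReal_zero]
      constructor
      · rintro ⟨h₁, h₂⟩; linarith
      · intro; constructor <;> linarith
  unfold mrear
  simp_rw [key]
  rw [setIntegral_indicator measurableSet_Iic, Ioi_inter_Iic, setIntegral_const]
  simp only [smul_eq_mul, mul_one, measureReal_def, Real.volume_Ioc]
  rw [ENNReal.toReal_ofReal] <;> linarith

theorem le_Ifun_mrear_bump {a : ℝ → ℝ → ℝ} {s t v ε C : ℝ} (hs : -1 < s) (ht : t < 1)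
    (hv : 0 ≤ v) (hε : 0 < ε) (hst : 2 * ε < t - s)
    (hC : ∀ x ∈ Icc (-1 : ℝ) 1, x ∈ Icc (1 - t + s) (1 - t + s + 2 * ε) →
      ∀ y ∈ Icc v (v + ε), C ≤ a x y) :
    ENNReal.ofReal (C / 2) * ENNReal.ofReal (2 * ε) ≤
      Ifun (fun _ p => p) a (mrear (bump s t v ε)) := by
  set w := 1 - t + s with hw
  have hsub : Ioo w (w + 2 * ε) ⊆ Icc (-1 : ℝ) 1 := fun x hx =>
    ⟨by linarith [hx.1], by linarith [hx.2]⟩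
  calc ENNReal.ofReal (C / 2) * ENNReal.ofReal (2 * ε)
      = ∫⁻ _ in Ioo w (w + 2 * ε), ENNReal.ofReal (C / 2) := by
        rw [setLIntegral_const, Real.volume_Ioo, add_sub_cancel_left]
    _ ≤ ∫⁻ x in Ioo w (w + 2 * ε), ENNReal.ofReal
          (a x (mrear (bump s t v ε) x) * |deriv (mrear (bump s t v ε)) x|) := by
        refine setLIntegral_mono' measurableSet_Ioo fun x hx => ENNReal.ofReal_le_ofReal ?_
        have heq : mrear (bump s t v ε) =ᶠ[nhds x] fun y => v + (y - w) / 2 := by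
          filter_upwards [Ioo_mem_nhds hx.1 hx.2] with y hy
            using mrear_bump hs ht hv hε hst hy
        have hder : HasDerivAt (fun y : ℝ => v + (y - w) / 2) (1 / 2) x :=
          (((hasDerivAt_id x).sub_const w).div_const 2).const_add v
        rw [heq.deriv_eq, hder.deriv, heq.self_of_nhds, abs_of_pos (by norm_num : (0 : ℝ) < 1 / 2)]
        have := hC x (hsub hx) ⟨hx.1.le, hx.2.le⟩ (v + (x - w) / 2)
          ⟨by linarith [hx.1], by linarith [hx.2]⟩
        linarith
    _ ≤ Ifun (fun _ p => p) a (mrear (bump s t v ε)) := lintegral_mono_set hsub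

theorem Weight.exists_close {a : ℝ → ℝ → ℝ} (ha : Weight a) {x₀ v η : ℝ}
    (hx₀ : x₀ ∈ Icc (-1 : ℝ) 1) (hv : 0 ≤ v) (hη : 0 < η) :
    ∃ r > 0, ∀ x ∈ Icc (-1 : ℝ) 1, |x - x₀| < r → ∀ y, 0 ≤ y → |y - v| < r →
      |a x y - a x₀ v| < η := by
  obtain ⟨r, hr, h⟩ := Metric.continuousOn_iff.1 ha.1 (x₀, v) ⟨hx₀, hv⟩ η hη
  refine ⟨r, hr, fun x hx hxr y hy hyr => ?_⟩
  simpa [Real.dist_eq] using h (x, y) ⟨hx, hy⟩ (by simpa [Prod.dist_eq, Real.dist_eq] using ⟨hxr, hyr⟩)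

/-- Condition (C) at interior points, tested with small bumps and the total variation. -/
theorem condC_interior {a : ℝ → ℝ → ℝ} (ha : Weight a)
    (H : ∀ u : ℝ → ℝ, PiecewiseLinear u → (∀ x ∈ Icc (-1 : ℝ) 1, 0 ≤ u x) →
      Ifun (fun _ p => p) a (mrear u) ≤ Ifun (fun _ p => p) a u)
    {s t v : ℝ} (hs : -1 < s) (hst : s < t) (ht : t < 1) (hv : 0 ≤ v) :
    a (1 - t + s) v ≤ a s v + a t v := by
  refine le_of_forall_pos_le_add fun δ hδ => ?_
  have hη : 0 < δ / 3 := by positivity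
  have hsm : s ∈ Icc (-1 : ℝ) 1 := ⟨by linarith, by linarith⟩
  have htm : t ∈ Icc (-1 : ℝ) 1 := ⟨by linarith, by linarith⟩
  obtain ⟨r₁, hr₁, h₁⟩ := ha.exists_close hsm hv hη
  obtain ⟨r₂, hr₂, h₂⟩ := ha.exists_close htm hv hη
  obtain ⟨r₃, hr₃, h₃⟩ := ha.exists_close (x₀ := 1 - t + s) ⟨by linarith, by linarith⟩ hv hη
  obtain ⟨ε, hε, hε'⟩ := exists_between
    (show 0 < min (min r₁ r₂) (min (r₃ / 2) ((t - s) / 2)) by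
      have : 0 < t - s := by linarith
      positivity)
  simp only [lt_min_iff] at hε'
  obtain ⟨⟨e₁, e₂⟩, e₃, e₄⟩ := hε'
  have hub := Ifun_bump_le ha (s := s) (t := t) (A := a s v + δ / 3) (B := a t v + δ / 3) hv hε
    (fun x hx hxs y hy => by
      have := h₁ x hx (abs_lt.2 ⟨by linarith [hxs.1], by linarith [hxs.2]⟩) y (hv.trans hy.1)
        (abs_lt.2 ⟨by linarith [hy.1], by linarith [hy.2]⟩)
      linarith [(abs_lt.1 this).2])
    (fun x hx hxt y hy => by
      have := h₂ x hx (abs_lt.2 ⟨by linarith [hxt.1], by linarith [hxt.2]⟩) y (hv.trans hy.1)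
        (abs_lt.2 ⟨by linarith [hy.1], by linarith [hy.2]⟩)
      linarith [(abs_lt.1 this).2])
  have hlb := le_Ifun_mrear_bump (a := a) (C := a (1 - t + s) v - δ / 3) hs ht hv hε
    (by linarith) (fun x hx hxw y hy => by
      have := h₃ x hx (abs_lt.2 ⟨by linarith [hxw.1], by linarith [hxw.2]⟩) y (hv.trans hy.1)
        (abs_lt.2 ⟨by linarith [hy.1], by linarith [hy.2]⟩)
      linarith [(abs_lt.1 this).1])
  have hmain := hlb.trans ((H _ (piecewiseLinear_bump hs ht hε (by linarith))
    fun x _ => hv.trans (le_bump ..)).trans hub)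
  have hA : 0 ≤ a s v + δ / 3 := by linarith [ha.2 s v hsm hv]
  have hB : 0 ≤ a t v + δ / 3 := by linarith [ha.2 t v htm hv]
  rw [← ENNReal.ofReal_mul' (by positivity), ← ENNReal.ofReal_mul hA, ← ENNReal.ofReal_mul hB,
    ← ENNReal.ofReal_add (by positivity) (by positivity),
    ENNReal.ofReal_le_ofReal_iff (by positivity)] at hmain
  have : (a (1 - t + s) v - δ / 3) * ε ≤ (a s v + δ / 3 + (a t v + δ / 3)) * ε := by linarith
  linarith [le_of_mul_le_mul_right this hε]

/-- if `I(a,u*) ≤ I(a,u)` for every `F ∈ 𝔉` and every nonnegative piecewise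
linear `u`, then `a` satisfies condition (C). -/
theorem stmt1 (a : ℝ → ℝ → ℝ) (ha : Weight a)
    (H : ∀ F : ℝ → ℝ → ℝ, MemFrakF F →
      ∀ u : ℝ → ℝ, PiecewiseLinear u → (∀ x ∈ Icc (-1 : ℝ) 1, 0 ≤ u x) →
        Ifun F a (mrear u) ≤ Ifun F a u) :
    CondC a := by
  have hint : ∀ {s t v : ℝ}, -1 < s → s < t → t < 1 → 0 ≤ v →
      a (1 - t + s) v ≤ a s v + a t v := condC_interior ha (H _ memFrakF_snd)
  intro s t v hs hst ht hv
  have hlim : ∀ f : ℝ → ℝ, Continuous f → (∀ θ ∈ Ioo (0 : ℝ) 1, f θ ∈ Icc (-1 : ℝ) 1) →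
      f 0 ∈ Icc (-1 : ℝ) 1 →
      Tendsto (fun θ => a (f θ) v) (nhdsWithin 0 (Ioo 0 1)) (nhds (a (f 0) v)) := by
    intro f hf hmem h0
    have hpair : Tendsto (fun θ => (f θ, v)) (nhdsWithin 0 (Ioo 0 1))
        (nhdsWithin (f 0, v) (Icc (-1 : ℝ) 1 ×ˢ Ici (0 : ℝ))) :=
      tendsto_nhdsWithin_iff.2 ⟨((hf.prodMk continuous_const).tendsto 0).mono_left
        nhdsWithin_le_nhds, eventually_nhdsWithin_of_forall fun θ hθ => ⟨hmem θ hθ, hv⟩⟩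
    exact (ha.1 (f 0, v) ⟨h0, hv⟩).tendsto.comp hpair
  -- `(s, t)` is approached along the segment towards `(-1/2, 1/2)`.
  have hbd : ∀ θ ∈ Ioo (0 : ℝ) 1, -1 < s + θ * (-1 / 2 - s) ∧
      s + θ * (-1 / 2 - s) < t + θ * (1 / 2 - t) ∧ t + θ * (1 / 2 - t) < 1 := by
    rintro θ ⟨h0, h1⟩
    refine ⟨?_, ?_, ?_⟩ <;> nlinarith
  have h₁ := hlim (fun θ => s + θ * (-1 / 2 - s)) (by fun_prop)
    (fun θ hθ => by obtain ⟨_, _, _⟩ := hbd θ hθ; constructor <;> linarith)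
    (by constructor <;> linarith)
  have h₂ := hlim (fun θ => t + θ * (1 / 2 - t)) (by fun_prop)
    (fun θ hθ => by obtain ⟨_, _, _⟩ := hbd θ hθ; constructor <;> linarith)
    (by constructor <;> linarith)
  have h₃ := hlim (fun θ => 1 - (t + θ * (1 / 2 - t)) + (s + θ * (-1 / 2 - s))) (by fun_prop)
    (fun θ hθ => by obtain ⟨_, _, _⟩ := hbd θ hθ; constructor <;> linarith)
    (by constructor <;> linarith)
  simp only [zero_mul, add_zero] at h₁ h₂ h₃
  have : (nhdsWithin (0 : ℝ) (Ioo 0 1)).NeBot := left_nhdsWithin_Ioo_neBot one_pos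
  refine le_of_tendsto_of_tendsto h₃ (h₁.add h₂) ?_
  refine eventually_nhdsWithin_of_forall fun θ hθ => ?_
  obtain ⟨k₁, k₂, k₃⟩ := hbd θ hθ
  exact hint k₁ k₂ k₃ hv
end
end

section
/- Let a : [-1,1] → [0,∞) be continuous and satisfy condition (C). Then for every n ≥ 1 and all -1 ≤ t₁ ≤ t₂ ≤ ... ≤ t_n ≤ 1 the following holds: if n is even, then Σ_{k=1}^n a(t_k) ≥ a(1 - Σ_{k=1}^n (-1)^k t_k); if n is odd, then Σ_{k=1}^n a(t_k) ≥ a(- Σ_{k=1}^n (-1)^k t_k). (In each case the argument of a on the right-hand side lies in [-1,1].) -/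
open MeasureTheory Set Filter
open scoped ENNReal BigOperators NNReal

noncomputable section

/-- The argument of the weight on the right-hand side of the sum inequality. -/
def altPoint {n : ℕ} (t : Fin n → ℝ) : ℝ :=
  (if Even n then 1 else 0) - ∑ i : Fin n, (-1 : ℝ) ^ ((i : ℕ) + 1) * t i

lemma altPoint_succ {n : ℕ} (t : Fin (n + 1) → ℝ) :
    altPoint t = 1 - altPoint (fun i : Fin n => t i.succ) + t 0 := by
  simp only [altPoint, Fin.sum_univ_succ, Fin.val_succ, Fin.val_zero, pow_succ _ (_ + 1),
    mul_neg_one, neg_mul, Finset.sum_neg_distrib, Nat.even_add_one]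
  split_ifs <;> ring

lemma CondC1.altPoint_mem_and_le_sum {a : ℝ → ℝ} (hC : CondC1 a) {n : ℕ} (t : Fin (n + 1) → ℝ)
    (hmono : Monotone t) (ht : ∀ i, t i ∈ Icc (-1 : ℝ) 1) :
    altPoint t ∈ Icc (t 0) 1 ∧ a (altPoint t) ≤ ∑ i, a (t i) := by
  induction n with
  | zero => simpa [altPoint] using (ht 0).2
  | succ n ih =>
    obtain ⟨⟨hlow, hup⟩, hle⟩ := ih (fun i => t i.succ)
      (fun i j hij => hmono (Fin.succ_le_succ_iff.2 hij)) (fun i => ht i.succ)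
    have h0 : t 0 ≤ altPoint fun i : Fin (n + 1) => t i.succ :=
      (hmono (Fin.zero_le _)).trans hlow
    rw [altPoint_succ, Fin.sum_univ_succ]
    refine ⟨⟨by linarith, by linarith⟩, ?_⟩
    linarith [hC _ _ (ht 0).1 h0 hup]

/-- sum inequalities for a weight satisfying condition (C). -/
theorem stmt2 (a : ℝ → ℝ) (hcont : ContinuousOn a (Icc (-1 : ℝ) 1))
    (hnn : ∀ x ∈ Icc (-1 : ℝ) 1, 0 ≤ a x) (hC : CondC1 a)
    (n : ℕ) (hn : 1 ≤ n) (t : Fin n → ℝ) (hmono : Monotone t)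
    (ht : ∀ i, t i ∈ Icc (-1 : ℝ) 1) :
    (Even n → a (1 - ∑ i : Fin n, (-1 : ℝ) ^ ((i : ℕ) + 1) * t i) ≤ ∑ i : Fin n, a (t i)) ∧
    (Odd n → a (-∑ i : Fin n, (-1 : ℝ) ^ ((i : ℕ) + 1) * t i) ≤ ∑ i : Fin n, a (t i)) := by
  obtain ⟨m, rfl⟩ := Nat.exists_eq_add_of_le' hn
  have h := (hC.altPoint_mem_and_le_sum t hmono ht).2
  refine ⟨fun he => ?_, fun ho => ?_⟩
  · rwa [altPoint, if_pos he] at h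
  · rwa [altPoint, if_neg (Nat.not_even_iff_odd.2 ho), zero_sub] at h
end
end

section
/- Let a : [-1,1] → [0,∞) be continuous, satisfy condition (C), and be even, i.e. a(-x) = a(x) for all x ∈ [-1,1]. Then for every n ≥ 1 and all -1 ≤ t₁ ≤ t₂ ≤ ... ≤ t_n ≤ 1 the following holds: if n is even, then Σ_{k=1}^n a(t_k) ≥ a(-1 + Σ_{k=1}^n (-1)^k t_k); if n is odd, then Σ_{k=1}^n a(t_k) ≥ a(Σ_{k=1}^n (-1)^k t_k). (In each case the argument of a on the right-hand side lies in [-1,1].) -/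
open MeasureTheory Set Filter
open scoped ENNReal BigOperators NNReal

noncomputable section

/-- The alternating sum of a monotone tuple in `[-1, 1]` stays in the range required to apply
condition (C) once more, and the weight there is bounded by the sum of the weights. -/
theorem CondC1.alternating_sum_le {a : ℝ → ℝ} (hC : CondC1 a)
    (heven : ∀ x ∈ Icc (-1 : ℝ) 1, a (-x) = a x) (n : ℕ) (t : Fin (n + 1) → ℝ)
    (hmono : Monotone t) (ht : ∀ i, t i ∈ Icc (-1 : ℝ) 1) :
    (Even (n + 1) → 0 ≤ ∑ i : Fin (n + 1), (-1 : ℝ) ^ ((i : ℕ) + 1) * t i ∧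
      ∑ i : Fin (n + 1), (-1 : ℝ) ^ ((i : ℕ) + 1) * t i ≤ 1 + t (Fin.last n) ∧
      a (-1 + ∑ i : Fin (n + 1), (-1 : ℝ) ^ ((i : ℕ) + 1) * t i) ≤ ∑ i, a (t i)) ∧
    (Odd (n + 1) → -t (Fin.last n) ≤ ∑ i : Fin (n + 1), (-1 : ℝ) ^ ((i : ℕ) + 1) * t i ∧
      ∑ i : Fin (n + 1), (-1 : ℝ) ^ ((i : ℕ) + 1) * t i ≤ 1 ∧
      a (∑ i : Fin (n + 1), (-1 : ℝ) ^ ((i : ℕ) + 1) * t i) ≤ ∑ i, a (t i)) := by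
  induction n with
  | zero =>
    have h := (ht 0).1
    refine ⟨fun h => absurd h (by decide), fun _ => ?_⟩
    simp only [Fin.sum_univ_castSucc, Finset.univ_eq_empty, Finset.sum_empty, Fin.last_zero,
      Fin.val_zero, zero_add, pow_one, neg_one_mul]
    exact ⟨le_rfl, by linarith, (heven _ (ht 0)).le⟩
  | succ n ih =>
    obtain ⟨ih_even, ih_odd⟩ := ih (fun i => t i.castSucc)
      (fun i j h => hmono (Fin.castSucc_le_castSucc_iff.2 h)) (fun i => ht _)
    have hle : t (Fin.last n).castSucc ≤ t (Fin.last (n + 1)) := hmono (Fin.le_last _)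
    obtain ⟨hl, hu⟩ := ht (Fin.last (n + 1))
    rw [Fin.sum_univ_castSucc, Fin.sum_univ_castSucc (fun i => a (t i))]
    simp only [Fin.val_castSucc, Fin.val_last]
    set S := ∑ i : Fin (n + 1), (-1 : ℝ) ^ ((i : ℕ) + 1) * t i.castSucc
    set x := t (Fin.last (n + 1))
    refine ⟨fun hn => ?_, fun hn => ?_⟩
    · obtain ⟨h₁, h₂, h₃⟩ := ih_odd (by simpa [parity_simps] using hn)
      rw [hn.neg_one_pow, one_mul]
      refine ⟨by linarith, by linarith, ?_⟩
      have hS : S ∈ Icc (-1 : ℝ) 1 := ⟨by linarith, h₂⟩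
      have h := hC (-S) x (by linarith) (by linarith) hu
      rw [heven S hS, ← heven _ ⟨by linarith, by linarith⟩] at h
      rw [show -1 + (S + x) = -(1 - x + -S) by ring]
      linarith
    · obtain ⟨h₁, h₂, h₃⟩ := ih_even (by simpa [parity_simps] using hn)
      rw [hn.neg_one_pow, neg_one_mul]
      refine ⟨by linarith, by linarith, ?_⟩
      have h := hC (-1 + S) x (by linarith) (by linarith) hu
      rw [show S + -x = 1 - x + (-1 + S) by ring]
      linarith

/-- sum inequalities for an even weight satisfying condition (C). -/
theorem stmt3 (a : ℝ → ℝ) (hcont : ContinuousOn a (Icc (-1 : ℝ) 1))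
    (hnn : ∀ x ∈ Icc (-1 : ℝ) 1, 0 ≤ a x) (hC : CondC1 a)
    (heven : ∀ x ∈ Icc (-1 : ℝ) 1, a (-x) = a x)
    (n : ℕ) (hn : 1 ≤ n) (t : Fin n → ℝ) (hmono : Monotone t)
    (ht : ∀ i, t i ∈ Icc (-1 : ℝ) 1) :
    (Even n → a (-1 + ∑ i : Fin n, (-1 : ℝ) ^ ((i : ℕ) + 1) * t i) ≤ ∑ i : Fin n, a (t i)) ∧
    (Odd n → a (∑ i : Fin n, (-1 : ℝ) ^ ((i : ℕ) + 1) * t i) ≤ ∑ i : Fin n, a (t i)) := by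
  obtain ⟨m, rfl⟩ := Nat.exists_eq_add_of_le' hn
  obtain ⟨h_even, h_odd⟩ := CondC1.alternating_sum_le hC heven m t hmono ht
  exact ⟨fun h => (h_even h).2.2, fun h => (h_odd h).2.2⟩
end
end

section
/- Let a : [-1,1] → [0,∞) be continuous and satisfy condition (C), and suppose a(x₀) = 0 for some x₀ ∈ [-1,1). Let Z := {x ∈ [x₀,1] : a(x) = 0}. Then either Z = [x₀,1], or there exists a positive integer m such that, with Δ := (1 - x₀)/m, for every x ∈ [x₀, 1-Δ] one has x ∈ Z if and only if x + Δ ∈ Z (in particular the zero set of a on [x₀,1] is periodic with period dividing 1 - x₀). -/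
open MeasureTheory Set Filter
open scoped ENNReal BigOperators NNReal

noncomputable section

/-- A subset of `[0, L]` containing `L` and closed under nonnegative differences is closed under
sums that do not exceed `L`. -/
lemma add_mem_of_sub_mem {A : Set ℝ} {L : ℝ} (hAL : A ⊆ Icc 0 L) (hL : L ∈ A)
    (hsub : ∀ p ∈ A, ∀ q ∈ A, q ≤ p → p - q ∈ A) {p q : ℝ} (hp : p ∈ A) (hq : q ∈ A)
    (hpq : p + q ≤ L) : p + q ∈ A := by
  have hp₀ := (hAL hp).1
  have hq₀ := (hAL hq).1
  have h := hsub _ hL _ (hsub _ (hsub _ hL p hp (by linarith)) q hq (by linarith)) (by linarith)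
  convert h using 1
  ring

lemma natCast_mul_mem_of_sub_mem {A : Set ℝ} {L : ℝ} (hAL : A ⊆ Icc 0 L) (hL : L ∈ A)
    (hsub : ∀ p ∈ A, ∀ q ∈ A, q ≤ p → p - q ∈ A) {p : ℝ} (hp : p ∈ A) (n : ℕ)
    (hn : n * p ≤ L) : (n : ℝ) * p ∈ A := by
  induction n with
  | zero => simpa using hsub L hL L hL le_rfl
  | succ k ih =>
    have hp₀ := (hAL hp).1
    push_cast [add_mul, one_mul] at hn ⊢
    exact add_mem_of_sub_mem hAL hL hsub (ih (by linarith)) hp hn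

/-- A closed subset of `[0, L]` containing `L` and closed under nonnegative differences is either
all of `[0, L]` or contains `L / m` for some positive integer `m`. -/
lemma eq_Icc_or_exists_div_mem {A : Set ℝ} {L : ℝ} (hL₀ : 0 < L) (hA : IsClosed A)
    (hAL : A ⊆ Icc 0 L) (hL : L ∈ A) (hsub : ∀ p ∈ A, ∀ q ∈ A, q ≤ p → p - q ∈ A) :
    A = Icc 0 L ∨ ∃ m : ℕ, 0 < m ∧ L / m ∈ A := by
  by_cases hsmall : ∀ ε > 0, ∃ p ∈ A, 0 < p ∧ p < ε
  · left
    refine hAL.antisymm fun y hy => ?_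
    rw [← hA.closure_eq, Metric.mem_closure_iff]
    intro ε hε
    obtain ⟨p, hp, hp₀, hpε⟩ := hsmall ε hε
    have hle := (le_div_iff₀ hp₀).1 (Nat.floor_le (div_nonneg hy.1 hp₀.le))
    have hlt := (div_lt_iff₀ hp₀).1 (Nat.lt_floor_add_one (y / p))
    refine ⟨_, natCast_mul_mem_of_sub_mem hAL hL hsub hp ⌊y / p⌋₊ (hle.trans hy.2), ?_⟩
    rw [Real.dist_eq, abs_lt]
    constructor <;> linarith
  · right
    push Not at hsmall
    obtain ⟨ε, hε, hmin⟩ := hsmall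
    obtain ⟨d, ⟨hd, hεd⟩, hleast⟩ := ((isCompact_Icc.of_isClosed_subset hA hAL).inter_right
      (isClosed_Ici (a := ε))).exists_isLeast ⟨L, hL, hmin L hL hL₀⟩
    have hd₀ : 0 < d := hε.trans_le hεd
    have hle := (le_div_iff₀ hd₀).1 (Nat.floor_le (div_nonneg hL₀.le hd₀.le))
    have hlt := (div_lt_iff₀ hd₀).1 (Nat.lt_floor_add_one (L / d))
    have hmem := hsub L hL _ (natCast_mul_mem_of_sub_mem hAL hL hsub hd ⌊L / d⌋₊ hle) hle
    have heq : L = ⌊L / d⌋₊ * d := by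
      by_contra hne
      have hpos : 0 < L - ⌊L / d⌋₊ * d := sub_pos.2 (lt_of_le_of_ne hle (Ne.symm hne))
      have := hleast ⟨hmem, hmin _ hmem hpos⟩
      linarith
    have hm : 0 < ⌊L / d⌋₊ := Nat.floor_pos.2 ((one_le_div hd₀).2 (hAL hd).2)
    refine ⟨⌊L / d⌋₊, hm, ?_⟩
    rwa [(div_eq_iff (by positivity)).2 (heq.trans (mul_comm _ _))]

/-- periodicity of the zero set of a weight satisfying condition (C). -/
theorem stmt4 (a : ℝ → ℝ) (hcont : ContinuousOn a (Icc (-1 : ℝ) 1))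
    (hnn : ∀ x ∈ Icc (-1 : ℝ) 1, 0 ≤ a x) (hC : CondC1 a)
    (x₀ : ℝ) (hx₀ : x₀ ∈ Ico (-1 : ℝ) 1) (hzero : a x₀ = 0) :
    {x ∈ Icc x₀ 1 | a x = 0} = Icc x₀ 1 ∨
    ∃ m : ℕ, 0 < m ∧ ∀ x ∈ Icc x₀ (1 - (1 - x₀) / m),
      (x ∈ {x ∈ Icc x₀ 1 | a x = 0} ↔ x + (1 - x₀) / m ∈ {x ∈ Icc x₀ 1 | a x = 0}) := by
  obtain ⟨hx₁, hx₂⟩ := hx₀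
  set A : Set ℝ := Icc 0 (1 - x₀) ∩ (fun y => a (1 - y)) ⁻¹' {0} with hA_def
  have hmem (x : ℝ) : 1 - x ∈ A ↔ x ∈ {x ∈ Icc x₀ 1 | a x = 0} := by
    simp only [hA_def, mem_inter_iff, mem_Icc, mem_preimage, mem_singleton_iff, mem_ofPred_eq,
      sub_sub_cancel, sub_nonneg, sub_le_sub_iff_left]
    tauto
  have hA : IsClosed A := by
    refine ContinuousOn.preimage_isClosed_of_isClosed ?_ isClosed_Icc isClosed_singleton
    refine hcont.comp (by fun_prop) fun y hy => ?_
    constructor <;> linarith [hy.1, hy.2]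
  have hL : 1 - x₀ ∈ A := (hmem x₀).2 ⟨⟨le_rfl, hx₂.le⟩, hzero⟩
  have hsub : ∀ p ∈ A, ∀ q ∈ A, q ≤ p → p - q ∈ A := by
    rintro p ⟨⟨hp₀, hp₁⟩, hp⟩ q ⟨⟨hq₀, hq₁⟩, hq⟩ hqp
    simp only [mem_preimage, mem_singleton_iff] at hp hq
    refine ⟨⟨by linarith, by linarith⟩, le_antisymm ?_ (hnn _ ⟨by linarith, by linarith⟩)⟩
    have h := hC (1 - p) (1 - q) (by linarith) (by linarith) (by linarith)
    rw [hp, hq, add_zero] at h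
    rwa [show 1 - (1 - q) + (1 - p) = 1 - (p - q) by ring] at h
  rcases eq_Icc_or_exists_div_mem (by linarith) hA inter_subset_left hL hsub with h | ⟨m, hm, h⟩
  · left
    ext x
    rw [← hmem, h, mem_Icc, mem_Icc]
    constructor <;> rintro ⟨h₁, h₂⟩ <;> constructor <;> linarith
  · refine Or.inr ⟨m, hm, fun x hx => ?_⟩
    rw [← hmem, ← hmem]
    constructor <;> intro hxA
    · convert hsub _ hxA _ h (by linarith [hx.2]) using 1
      ring
    · convert add_mem_of_sub_mem inter_subset_left hL hsub hxA h (by linarith [hx.1]) using 1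
      ring
end
end

section
/- Let a : [-1,1] → [0,∞) satisfy condition (C) and let k be a positive integer. Let a_k : [-1,1] → [0,∞) be the piecewise linear interpolation of a with nodes x_i := -1 + 2i/k, i = 0,1,...,k; that is, a_k(x_i) = a(x_i) for each i and a_k is affine on each segment [x_i, x_{i+1}]. Then a_k also satisfies condition (C). -/
open MeasureTheory Set Filter
open scoped ENNReal BigOperators NNReal

noncomputable section

/-- A point of `[0, k]` lies in the unit cell with index `min ⌊p⌋₊ (k - 1)`. -/
lemma exists_unit_cell_offset {k : ℕ} (hk : 0 < k) {p : ℝ} (hp0 : 0 ≤ p) (hpk : p ≤ k) :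
    ∃ α : ℝ, 0 ≤ α ∧ α ≤ 1 ∧ p = (min ⌊p⌋₊ (k - 1) : ℕ) + α := by
  refine ⟨p - (min ⌊p⌋₊ (k - 1) : ℕ), ?_, ?_, by ring⟩
  · have h : ((min ⌊p⌋₊ (k - 1) : ℕ) : ℝ) ≤ (⌊p⌋₊ : ℝ) := by exact_mod_cast min_le_left _ _
    linarith [Nat.floor_le hp0]
  · rcases min_choice ⌊p⌋₊ (k - 1) with h | h <;> rw [h]
    · linarith [Nat.lt_floor_add_one p]
    · rw [Nat.cast_sub hk]
      push_cast
      linarith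

/-- If `F` is affine on each cell `[i, i + 1]`, `i < k`, then the inequality
`F (k - q + p) ≤ F p + F q` for `0 ≤ p ≤ q ≤ k` follows from the integer case. -/
lemma le_add_of_affine_on_unit_cells {F : ℝ → ℝ} {k : ℕ} (hk : 0 < k)
    (haff : ∀ i : ℕ, i < k → ∀ α : ℝ, 0 ≤ α → α ≤ 1 →
      F (i + α) = (1 - α) * F i + α * F (i + 1 : ℕ))
    (hint : ∀ i j m : ℕ, i ≤ j → j ≤ k → m + j = k + i → F m ≤ F i + F j)
    {p q : ℝ} (hp : 0 ≤ p) (hpq : p ≤ q) (hq : q ≤ k) :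
    F (k - q + p) ≤ F p + F q := by
  obtain ⟨α, hα0, hα1, hpα⟩ := exists_unit_cell_offset hk hp (hpq.trans hq)
  obtain ⟨β, hβ0, hβ1, hqβ⟩ := exists_unit_cell_offset hk (hp.trans hpq) hq
  have hij : min ⌊p⌋₊ (k - 1) ≤ min ⌊q⌋₊ (k - 1) := min_le_min_right _ (Nat.floor_mono hpq)
  have hjk : min ⌊q⌋₊ (k - 1) < k := by omega
  generalize min ⌊p⌋₊ (k - 1) = i at *
  generalize min ⌊q⌋₊ (k - 1) = j at *
  subst hpα hqβ
  rw [haff i (by omega) α hα0 hα1, haff j hjk β hβ0 hβ1]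
  rcases le_or_gt α β with hαβ | hαβ
  · obtain ⟨m, hm⟩ : ∃ m : ℕ, m + 1 + j = k + i := ⟨k - 1 + i - j, by omega⟩
    have hmR : (m : ℝ) + 1 + j = k + i := by exact_mod_cast hm
    rw [show (k : ℝ) - (j + β) + (i + α) = m + (1 - (β - α)) by linarith,
      haff m (by omega) _ (by linarith) (by linarith)]
    have h₁ := hint i j (m + 1) hij (by omega) (by omega)
    have h₂ := hint (i + 1) (j + 1) (m + 1) (by omega) (by omega) (by omega)
    have h₃ := hint i (j + 1) m (by omega) (by omega) (by omega)
    linarith [mul_le_mul_of_nonneg_left h₁ (sub_nonneg.2 hβ1),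
      mul_le_mul_of_nonneg_left h₂ hα0,
      mul_le_mul_of_nonneg_left h₃ (sub_nonneg.2 hαβ)]
  · have hlt : i < j := by
      refine lt_of_le_of_ne hij ?_
      rintro rfl
      linarith
    obtain ⟨m, hm⟩ : ∃ m : ℕ, m + j = k + i := ⟨k + i - j, by omega⟩
    have hmR : (m : ℝ) + j = k + i := by exact_mod_cast hm
    rw [show (k : ℝ) - (j + β) + (i + α) = m + (α - β) by linarith,
      haff m (by omega) _ (by linarith) (by linarith)]
    have h₁ := hint i j m hij (by omega) hm
    have h₂ := hint (i + 1) (j + 1) m (by omega) (by omega) (by omega)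
    have h₃ := hint (i + 1) j (m + 1) (by omega) (by omega) (by omega)
    linarith [mul_le_mul_of_nonneg_left h₁ (sub_nonneg.2 hα1),
      mul_le_mul_of_nonneg_left h₂ hβ0,
      mul_le_mul_of_nonneg_left h₃ (sub_nonneg.2 hαβ.le)]

/-- the piecewise linear interpolation of a weight satisfying condition (C),
with nodes `-1 + 2i/k`, also satisfies condition (C). -/
theorem stmt7 (a ak : ℝ → ℝ) (hnn : ∀ x ∈ Icc (-1 : ℝ) 1, 0 ≤ a x) (hC : CondC1 a)
    (k : ℕ) (hk : 0 < k)
    (hnodes : ∀ i : ℕ, i ≤ k → ak (-1 + 2 * (i : ℝ) / k) = a (-1 + 2 * (i : ℝ) / k))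
    (haffine : ∀ i : ℕ, i < k → ∃ c d : ℝ,
      ∀ y ∈ Icc (-1 + 2 * (i : ℝ) / k) (-1 + 2 * ((i : ℝ) + 1) / k), ak y = c * y + d) :
    CondC1 ak := by
  have hkR : (0 : ℝ) < k := by exact_mod_cast hk
  intro s t hs hst ht
  have key := le_add_of_affine_on_unit_cells (F := fun p => ak (-1 + 2 * p / k)) hk ?_ ?_
    (p := (s + 1) * k / 2) (q := (t + 1) * k / 2)
    (by have : 0 ≤ s + 1 := by linarith
        positivity)
    (by gcongr) (by nlinarith)
  · have hx : ∀ x : ℝ, -1 + 2 * ((x + 1) * k / 2) / k = x := fun x => by field_simp; ring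
    have hr : -1 + 2 * (k - (t + 1) * k / 2 + (s + 1) * k / 2) / k = 1 - t + s := by
      field_simp
      ring
    simpa only [hx, hr] using key
  · intro i hi α hα0 hα1
    obtain ⟨c, d, hcd⟩ := haffine i hi
    have hcell : ∀ β : ℝ, 0 ≤ β → β ≤ 1 →
        ak (-1 + 2 * (i + β) / k) = c * (-1 + 2 * (i + β) / k) + d := fun β hβ0 hβ1 =>
      hcd _ ⟨by gcongr; linarith, by gcongr⟩
    have h₀ := hcell 0 le_rfl zero_le_one
    rw [add_zero] at h₀
    push_cast
    rw [hcell α hα0 hα1, h₀, hcell 1 zero_le_one le_rfl]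
    ring
  · intro i j m hij hjk hm
    have hijR : (i : ℝ) ≤ j := by exact_mod_cast hij
    have hjkR : (j : ℝ) ≤ k := by exact_mod_cast hjk
    have hmR : (m : ℝ) = k + i - j := by
      rw [eq_sub_iff_add_eq]
      exact_mod_cast hm
    rw [hnodes i (by omega), hnodes j hjk, hnodes m (by omega)]
    have hr : -1 + 2 * (m : ℝ) / k = 1 - (-1 + 2 * (j : ℝ) / k) + (-1 + 2 * (i : ℝ) / k) := by
      rw [hmR]
      field_simp
      ring
    rw [hr]
    refine hC _ _ (le_add_of_nonneg_right (by positivity)) (by gcongr) ?_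
    have : 2 * (j : ℝ) / k ≤ 2 := by
      rw [div_le_iff₀ hkR]
      linarith
    linarith
end
end

section
/- Let a : [-1,1] × [0,∞) → [0,∞) be continuous, even with respect to the first argument (a(x,v) = a(-x,v) for all x, v), and satisfy condition (C), and let F ∈ 𝔉. Then for every nonnegative piecewise linear function u on [-1,1] one has I(a,u*) ≤ I(a,u). -/
open MeasureTheory Set Filter
open scoped ENNReal BigOperators NNReal

noncomputable section

/-- Partition and affine pieces of a piecewise linear function, indexed by natural numbers. -/
structure AffinePieces (u : ℝ → ℝ) (n : ℕ) (x c d : ℕ → ℝ) : Prop where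
  left : x 0 = -1
  right : x n = 1
  lt : ∀ i < n, x i < x (i + 1)
  eq : ∀ i < n, ∀ y ∈ Icc (x i) (x (i + 1)), u y = c i * y + d i

lemma PiecewiseLinear.exists_affinePieces {u : ℝ → ℝ} (hu : PiecewiseLinear u) :
    ∃ n x c d, AffinePieces u n x c d := by
  obtain ⟨n, x, h0, h1, hm, h⟩ := hu
  choose c d h using h
  refine ⟨n, fun i => if hi : i < n + 1 then x ⟨i, hi⟩ else 0,
    fun i => if hi : i < n then c ⟨i, hi⟩ else 0,
    fun i => if hi : i < n then d ⟨i, hi⟩ else 0, ?_, ?_, ?_, ?_⟩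
  · simpa using h0
  · simpa [Fin.last] using h1
  · intro i hi
    have h2 : i < n + 1 := by omega
    simp only [h2, Nat.add_lt_add_right hi 1, dif_pos]
    exact hm (by simp [Fin.lt_def])
  · intro i hi y hy
    have h2 : i < n + 1 := by omega
    simp only [h2, Nat.add_lt_add_right hi 1, dif_pos] at hy
    simp only [hi, dif_pos]
    exact h ⟨i, hi⟩ y hy

/-- The levels strictly between the values of `u` at the end points of the `i`-th piece. -/
def crossLevels (u : ℝ → ℝ) (x : ℕ → ℝ) (i : ℕ) : Set ℝ :=
  Ioo (min (u (x i)) (u (x (i + 1)))) (max (u (x i)) (u (x (i + 1))))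

/-- Measure of the part of `{u > t}` in `(l, r]`. -/
def superMeasure (u : ℝ → ℝ) (l r t : ℝ) : ℝ :=
  volume.real {y ∈ Ioc l r | t < u y}

/-- The distribution function of `u` on `[-1,1]`. -/
def distrib (u : ℝ → ℝ) (t : ℝ) : ℝ := (volume {y ∈ Icc (-1 : ℝ) 1 | u y > t}).toReal

lemma superMeasure_nonneg (u : ℝ → ℝ) (l r t : ℝ) : 0 ≤ superMeasure u l r t :=
  measureReal_nonneg

lemma superMeasure_self (u : ℝ → ℝ) (l t : ℝ) : superMeasure u l l t = 0 := by
  have : {y ∈ Ioc l l | t < u y} = ∅ :=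
    subset_eq_empty (sep_subset _ _) (Ioc_self l)
  rw [superMeasure, this, measureReal_empty]

lemma superMeasure_le (u : ℝ → ℝ) {l r : ℝ} (h : l ≤ r) (t : ℝ) :
    superMeasure u l r t ≤ r - l := by
  have : superMeasure u l r t ≤ volume.real (Ioc l r) :=
    measureReal_mono (sep_subset _ _) (by simp)
  simpa [Real.volume_real_Ioc_of_le h] using this

lemma distrib_eq_superMeasure (u : ℝ → ℝ) (t : ℝ) : distrib u t = superMeasure u (-1) 1 t := by
  unfold distrib superMeasure Measure.real
  congr 1
  apply measure_congr
  have := (Ioc_ae_eq_Icc (a := (-1 : ℝ)) (b := 1) (μ := volume)).symm.inter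
    (ae_eq_refl {y : ℝ | u y > t})
  exact this

lemma distrib_nonneg (u : ℝ → ℝ) (t : ℝ) : 0 ≤ distrib u t := ENNReal.toReal_nonneg

lemma volume_sep_Icc_ne_top (p : ℝ → Prop) : volume {y ∈ Icc (-1 : ℝ) 1 | p y} ≠ ∞ :=
  measure_ne_top_of_subset (sep_subset _ _) (by simp)

lemma distrib_antitone (u : ℝ → ℝ) : Antitone (distrib u) := fun _ _ hst =>
  ENNReal.toReal_mono (volume_sep_Icc_ne_top _)
    (measure_mono fun _ hy => ⟨hy.1, lt_of_le_of_lt hst hy.2⟩)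

namespace AffinePieces

variable {u : ℝ → ℝ} {n : ℕ} {x c d : ℕ → ℝ}

lemma le_of_le (h : AffinePieces u n x c d) {i j : ℕ} (hij : i ≤ j) (hj : j ≤ n) :
    x i ≤ x j := by
  induction j, hij using Nat.le_induction with
  | base => exact le_rfl
  | succ k hk ih => exact (ih (by omega)).trans (h.lt k (by omega)).le

lemma mem_Icc (h : AffinePieces u n x c d) {i : ℕ} (hi : i ≤ n) : x i ∈ Icc (-1 : ℝ) 1 :=
  ⟨h.left ▸ h.le_of_le (Nat.zero_le i) hi, h.right ▸ h.le_of_le hi le_rfl⟩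

lemma Icc_subset (h : AffinePieces u n x c d) {i : ℕ} (hi : i < n) :
    Icc (x i) (x (i + 1)) ⊆ Icc (-1) 1 :=
  Icc_subset_Icc (h.mem_Icc hi.le).1 (h.mem_Icc hi).2

lemma exists_mem_Icc (h : AffinePieces u n x c d) {y : ℝ} (hy : y ∈ Icc (-1 : ℝ) 1) :
    ∃ i < n, y ∈ Icc (x i) (x (i + 1)) := by
  have key : ∀ k ≤ n, 0 < k → y ≤ x k → ∃ i < n, y ∈ Icc (x i) (x (i + 1)) := by
    intro k
    induction k with
    | zero => intro _ h0; omega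
    | succ k ih =>
      intro hk _ hyk
      by_cases hxy : x k ≤ y
      · exact ⟨k, hk, hxy, hyk⟩
      · rcases Nat.eq_zero_or_pos k with rfl | hk0
        · exact absurd (h.left.trans_le hy.1) hxy
        · exact ih (by omega) hk0 (not_le.1 hxy).le
  refine key n le_rfl ?_ (hy.2.trans_eq h.right.symm)
  rcases Nat.eq_zero_or_pos n with rfl | h0
  · have := h.left.symm.trans h.right
    norm_num at this
  · exact h0

lemma measurableSet_sep (h : AffinePieces u n x c d) {S : Set ℝ} (hS : MeasurableSet S) :
    MeasurableSet {y ∈ Icc (-1 : ℝ) 1 | u y ∈ S} := by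
  have : {y ∈ Icc (-1 : ℝ) 1 | u y ∈ S} =
      ⋃ i ∈ Finset.range n, Icc (x i) (x (i + 1)) ∩ (fun y => c i * y + d i) ⁻¹' S := by
    ext y
    simp only [mem_ofPred_eq, mem_iUnion, Finset.mem_range, mem_inter_iff, mem_preimage,
      exists_prop]
    constructor
    · rintro ⟨hy, hyS⟩
      obtain ⟨i, hi, hyi⟩ := h.exists_mem_Icc hy
      exact ⟨i, hi, hyi, h.eq i hi y hyi ▸ hyS⟩
    · rintro ⟨i, hi, hyi, hyS⟩
      exact ⟨h.Icc_subset hi hyi, (h.eq i hi y hyi).symm ▸ hyS⟩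
  rw [this]
  refine Finset.measurableSet_biUnion _ fun i _ => measurableSet_Icc.inter ?_
  exact (by fun_prop : Measurable fun y : ℝ => c i * y + d i) hS

lemma superMeasure_succ (h : AffinePieces u n x c d) {k : ℕ} (hk : k < n) (t : ℝ) :
    superMeasure u (-1) (x (k + 1)) t =
      superMeasure u (-1) (x k) t + superMeasure u (x k) (x (k + 1)) t := by
  unfold superMeasure
  have hkl := h.mem_Icc hk.le
  have hlt := h.lt k hk
  have hne : ∀ l r : ℝ, volume {y ∈ Ioc l r | t < u y} ≠ ∞ := fun l r =>
    measure_ne_top_of_subset (sep_subset _ _) (by simp)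
  rw [← measureReal_union ?_ ?_ (hne _ _) (hne _ _)]
  · congr 1
    ext y
    simp only [mem_ofPred_eq, mem_union, mem_Ioc]
    constructor
    · rintro ⟨⟨h1, h2⟩, h3⟩
      rcases le_or_gt y (x k) with h4 | h4
      · exact Or.inl ⟨⟨h1, h4⟩, h3⟩
      · exact Or.inr ⟨⟨h4, h2⟩, h3⟩
    · rintro (⟨⟨h1, h2⟩, h3⟩ | ⟨⟨h1, h2⟩, h3⟩)
      · exact ⟨⟨h1, by linarith⟩, h3⟩
      · exact ⟨⟨by linarith [hkl.1], h2⟩, h3⟩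
  · rw [Set.disjoint_left]
    rintro y ⟨h1, _⟩ ⟨h2, _⟩
    exact absurd h1.2 (not_le.2 h2.1)
  · have : {y ∈ Ioc (x k) (x (k + 1)) | t < u y} =
        Ioc (x k) (x (k + 1)) ∩ {y ∈ Icc (-1 : ℝ) 1 | u y ∈ Ioi t} := by
      ext y
      constructor
      · rintro ⟨h1, h2⟩
        exact ⟨h1, h.Icc_subset hk (Ioc_subset_Icc_self h1), h2⟩
      · rintro ⟨h1, _, h2⟩
        exact ⟨h1, h2⟩
    rw [this]
    exact measurableSet_Ioc.inter (h.measurableSet_sep measurableSet_Ioi)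

lemma superMeasure_eq_sum (h : AffinePieces u n x c d) (t : ℝ) {k : ℕ} (hk : k ≤ n) :
    superMeasure u (-1) (x k) t =
      ∑ i ∈ Finset.range k, superMeasure u (x i) (x (i + 1)) t := by
  induction k with
  | zero => simp [h.left, superMeasure_self]
  | succ k ih => rw [h.superMeasure_succ hk, ih (by omega), Finset.sum_range_succ]

lemma distrib_eq_sum (h : AffinePieces u n x c d) (t : ℝ) :
    distrib u t = ∑ i ∈ Finset.range n, superMeasure u (x i) (x (i + 1)) t := by
  rw [distrib_eq_superMeasure, ← h.superMeasure_eq_sum t le_rfl, h.right]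

section Piece

variable (h : AffinePieces u n x c d) {i : ℕ} (hi : i < n)
include h hi

lemma eq_left : u (x i) = c i * x i + d i := h.eq i hi _ ⟨le_rfl, (h.lt i hi).le⟩

lemma eq_right : u (x (i + 1)) = c i * x (i + 1) + d i := h.eq i hi _ ⟨(h.lt i hi).le, le_rfl⟩

lemma superMeasure_of_lt_of_lt {t : ℝ} (hl : t < u (x i)) (hr : t < u (x (i + 1))) :
    superMeasure u (x i) (x (i + 1)) t = x (i + 1) - x i := by
  have : {y ∈ Ioc (x i) (x (i + 1)) | t < u y} = Ioc (x i) (x (i + 1)) := by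
    refine sep_eq_self_iff_mem_true.2 fun y hy => ?_
    rw [h.eq_left hi] at hl
    rw [h.eq_right hi] at hr
    rw [h.eq i hi y (Ioc_subset_Icc_self hy)]
    rcases le_total 0 (c i) with h0 | h0 <;> nlinarith [hy.1, hy.2]
  rw [superMeasure, this, Real.volume_real_Ioc_of_le (h.lt i hi).le]

lemma superMeasure_of_gt_of_gt {t : ℝ} (hl : u (x i) < t) (hr : u (x (i + 1)) < t) :
    superMeasure u (x i) (x (i + 1)) t = 0 := by
  have : {y ∈ Ioc (x i) (x (i + 1)) | t < u y} = ∅ := by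
    refine sep_eq_empty_iff_mem_false.2 fun y hy => not_lt.2 ?_
    rw [h.eq_left hi] at hl
    rw [h.eq_right hi] at hr
    rw [h.eq i hi y (Ioc_subset_Icc_self hy)]
    rcases le_total 0 (c i) with h0 | h0 <;> nlinarith [hy.1, hy.2]
  rw [superMeasure, this, measureReal_empty]

lemma slope_pos (hlr : u (x i) < u (x (i + 1))) : 0 < c i := by
  rw [h.eq_left hi, h.eq_right hi] at hlr
  have := h.lt i hi
  by_contra! hc
  nlinarith

lemma slope_neg (hlr : u (x (i + 1)) < u (x i)) : c i < 0 := by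
  rw [h.eq_left hi, h.eq_right hi] at hlr
  have := h.lt i hi
  by_contra! hc
  nlinarith

lemma slope_ne_zero {t : ℝ} (ht : t ∈ crossLevels u x i) : c i ≠ 0 := by
  rcases lt_trichotomy (u (x i)) (u (x (i + 1))) with h1 | h1 | h1
  · exact (h.slope_pos hi h1).ne'
  · simp [crossLevels, h1] at ht
  · exact (h.slope_neg hi h1).ne

lemma crossing_mem_Ioo {t : ℝ} (ht : t ∈ crossLevels u x i) :
    (t - d i) / c i ∈ Ioo (x i) (x (i + 1)) := by
  rcases lt_trichotomy (u (x i)) (u (x (i + 1))) with h1 | h1 | h1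
  · have hc := h.slope_pos hi h1
    rw [crossLevels, min_eq_left h1.le, max_eq_right h1.le, h.eq_left hi, h.eq_right hi] at ht
    constructor
    · rw [lt_div_iff₀ hc]; nlinarith [ht.1]
    · rw [div_lt_iff₀ hc]; nlinarith [ht.2]
  · simp [crossLevels, h1] at ht
  · have hc := h.slope_neg hi h1
    rw [crossLevels, min_eq_right h1.le, max_eq_left h1.le, h.eq_left hi, h.eq_right hi] at ht
    constructor
    · rw [lt_div_iff_of_neg hc]; nlinarith [ht.2]
    · rw [div_lt_iff_of_neg hc]; nlinarith [ht.1]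

lemma apply_crossing {t : ℝ} (ht : t ∈ crossLevels u x i) : u ((t - d i) / c i) = t := by
  have := h.slope_ne_zero hi ht
  rw [h.eq i hi _ (Ioo_subset_Icc_self (h.crossing_mem_Ioo hi ht))]
  field_simp
  ring

lemma superMeasure_of_gt_of_lt {t : ℝ} (hl : u (x i) < t) (hr : t < u (x (i + 1))) :
    superMeasure u (x i) (x (i + 1)) t = x (i + 1) - (t - d i) / c i := by
  have hc := h.slope_pos hi (hl.trans hr)
  have hp := h.crossing_mem_Ioo hi (t := t) ⟨by simp [hl], by simp [hr]⟩
  have : {y ∈ Ioc (x i) (x (i + 1)) | t < u y} = Ioc ((t - d i) / c i) (x (i + 1)) := by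
    ext y
    simp only [mem_ofPred_eq, mem_Ioc]
    constructor
    · rintro ⟨hy, hty⟩
      rw [h.eq i hi y (Ioc_subset_Icc_self hy)] at hty
      refine ⟨?_, hy.2⟩
      rw [div_lt_iff₀ hc]; linarith
    · rintro ⟨hy1, hy2⟩
      have hy : y ∈ Ioc (x i) (x (i + 1)) := ⟨hp.1.trans hy1, hy2⟩
      refine ⟨hy, ?_⟩
      rw [h.eq i hi y (Ioc_subset_Icc_self hy)]
      rw [div_lt_iff₀ hc] at hy1; linarith
  rw [superMeasure, this, Real.volume_real_Ioc_of_le hp.2.le]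

lemma superMeasure_of_lt_of_gt {t : ℝ} (hl : t < u (x i)) (hr : u (x (i + 1)) < t) :
    superMeasure u (x i) (x (i + 1)) t = (t - d i) / c i - x i := by
  have hc := h.slope_neg hi (hr.trans hl)
  have hp := h.crossing_mem_Ioo hi (t := t) ⟨by simp [hr], by simp [hl]⟩
  have : {y ∈ Ioc (x i) (x (i + 1)) | t < u y} = Ioo (x i) ((t - d i) / c i) := by
    ext y
    simp only [mem_ofPred_eq, mem_Ioo]
    constructor
    · rintro ⟨hy, hty⟩
      rw [h.eq i hi y (Ioc_subset_Icc_self hy)] at hty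
      refine ⟨hy.1, ?_⟩
      rw [lt_div_iff_of_neg hc]; linarith
    · rintro ⟨hy1, hy2⟩
      have hy : y ∈ Ioc (x i) (x (i + 1)) := ⟨hy1, (hy2.trans hp.2).le⟩
      refine ⟨hy, ?_⟩
      rw [h.eq i hi y (Ioc_subset_Icc_self hy)]
      rw [lt_div_iff_of_neg hc] at hy2; linarith
  rw [superMeasure, this, Real.volume_real_Ioo_of_le hp.1.le]

open Classical in
/-- Away from the end point values, the measure of `{u > t}` in a piece is locally affine in `t`. -/
lemma eventually_superMeasure {t : ℝ} (hl : u (x i) ≠ t) (hr : u (x (i + 1)) ≠ t) :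
    ∀ᶠ s in nhds t, superMeasure u (x i) (x (i + 1)) s =
      superMeasure u (x i) (x (i + 1)) t -
        (if t ∈ crossLevels u x i then |c i|⁻¹ else 0) * (s - t) := by
  rcases lt_or_gt_of_ne hl with hl | hl <;> rcases lt_or_gt_of_ne hr with hr | hr
  · have hnot : t ∉ crossLevels u x i := fun hm => absurd hm.2 (not_lt.2 (by simp [hl.le, hr.le]))
    filter_upwards [lt_mem_nhds hl, lt_mem_nhds hr] with s hsl hsr
    rw [h.superMeasure_of_gt_of_gt hi hl hr, h.superMeasure_of_gt_of_gt hi hsl hsr]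
    simp [hnot]
  · have hm : t ∈ crossLevels u x i := ⟨by simp [hl], by simp [hr]⟩
    filter_upwards [lt_mem_nhds hl, gt_mem_nhds hr] with s hsl hsr
    rw [h.superMeasure_of_gt_of_lt hi hl hr, h.superMeasure_of_gt_of_lt hi hsl hsr, if_pos hm,
      abs_of_pos (h.slope_pos hi (hl.trans hr))]
    ring
  · have hm : t ∈ crossLevels u x i := ⟨by simp [hr], by simp [hl]⟩
    filter_upwards [gt_mem_nhds hl, lt_mem_nhds hr] with s hsl hsr
    rw [h.superMeasure_of_lt_of_gt hi hl hr, h.superMeasure_of_lt_of_gt hi hsl hsr, if_pos hm,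
      abs_of_neg (h.slope_neg hi (hr.trans hl)), inv_neg]
    ring
  · have hnot : t ∉ crossLevels u x i := fun hm => absurd hm.1 (not_lt.2 (by simp [hl.le, hr.le]))
    filter_upwards [gt_mem_nhds hl, gt_mem_nhds hr] with s hsl hsr
    rw [h.superMeasure_of_lt_of_lt hi hl hr, h.superMeasure_of_lt_of_lt hi hsl hsr]
    simp [hnot]

end Piece

open Classical in
/-- Total inverse slope of `u` over the level `t`; minus the derivative of `distrib u` at `t`. -/
def _root_.crossDensity (u : ℝ → ℝ) (n : ℕ) (x c : ℕ → ℝ) (t : ℝ) : ℝ :=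
  ∑ i ∈ Finset.range n, if t ∈ crossLevels u x i then |c i|⁻¹ else 0

lemma eventually_distrib (h : AffinePieces u n x c d) {t : ℝ} (ht : ∀ i ≤ n, u (x i) ≠ t) :
    ∀ᶠ s in nhds t, distrib u s = distrib u t - crossDensity u n x c t * (s - t) := by
  have : ∀ᶠ s in nhds t, ∀ i ∈ Finset.range n, _ := (Finset.eventually_all _).2 fun i hi =>
    h.eventually_superMeasure (Finset.mem_range.1 hi) (ht i (Finset.mem_range.1 hi).le)
      (ht (i + 1) (Finset.mem_range.1 hi))
  filter_upwards [this] with s hs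
  rw [h.distrib_eq_sum, h.distrib_eq_sum, Finset.sum_congr rfl hs, Finset.sum_sub_distrib,
    crossDensity, Finset.sum_mul]

open Classical in
/-- The alternating-interval estimate: if `g` is nonnegative, subadditive and symmetric about `1`
on `[0,2]`, then `g` at the measure of `{u > t}` is at most the sum of its values at the distances
from `-1` to the crossings of the level `t`. -/
lemma le_sum_crossing (h : AffinePieces u n x c d) {t : ℝ} (ht : ∀ i ≤ n, u (x i) ≠ t)
    {g : ℝ → ℝ} (hg0 : ∀ l ∈ Icc (0 : ℝ) 2, 0 ≤ g l)
    (hgsymm : ∀ l ∈ Icc (0 : ℝ) 2, g (2 - l) = g l)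
    (hgadd : ∀ l m, 0 ≤ l → 0 ≤ m → l + m ≤ 2 → g (l + m) ≤ g l + g m)
    (hμ0 : 0 < distrib u t) (hμ2 : distrib u t < 2) :
    g (distrib u t) ≤ ∑ i ∈ Finset.range n,
      if t ∈ crossLevels u x i then g (1 + (t - d i) / c i) else 0 := by
  have hg : ∀ l m, 0 ≤ l → 0 ≤ m → l + m ≤ 2 → g l ≤ g m + g (l + m) := by
    intro l m hl hm hlm
    have := hgadd (2 - l - m) m (by linarith) hm (by linarith)
    rw [show 2 - l - m + m = 2 - l by ring, show 2 - l - m = 2 - (l + m) by ring,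
      hgsymm l ⟨hl, by linarith⟩, hgsymm (l + m) ⟨by linarith, hlm⟩] at this
    linarith
  set E : ℕ → ℝ := fun k => superMeasure u (-1) (x k) t with hE
  have hE0 : ∀ k, 0 ≤ E k := fun k => superMeasure_nonneg _ _ _ _
  have hE1 : ∀ k ≤ n, E k ≤ 1 + x k := fun k hk =>
    (superMeasure_le u (h.mem_Icc hk).1 t).trans_eq (by ring)
  have hE2 : ∀ k < n, E (k + 1) = E k + superMeasure u (x k) (x (k + 1)) t :=
    fun k hk => h.superMeasure_succ hk t
  set S : ℕ → ℝ := fun k => ∑ i ∈ Finset.range k,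
      if t ∈ crossLevels u x i then g (1 + (t - d i) / c i) else 0 with hS
  have hS1 : ∀ k, S (k + 1) = S k +
      if t ∈ crossLevels u x k then g (1 + (t - d k) / c k) else 0 :=
    fun k => Finset.sum_range_succ _ _
  have hS0 : ∀ k ≤ n, 0 ≤ S k := by
    refine fun k hk => Finset.sum_nonneg fun i hi => ?_
    have hi' : i < n := (Finset.mem_range.1 hi).trans_le hk
    split_ifs with hm
    · have := h.Icc_subset hi' (Ioo_subset_Icc_self (h.crossing_mem_Ioo hi' hm))
      exact hg0 _ ⟨by linarith [this.1], by linarith [this.2]⟩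
    · exact le_rfl
  have key : ∀ k ≤ n, (u (x k) < t → 0 < E k → g (E k) ≤ S k) ∧
      (t < u (x k) → 0 < 1 + x k - E k → g (1 + x k - E k) ≤ S k) := by
    intro k
    induction k with
    | zero =>
      have : E 0 = 0 := by simp [hE, h.left, superMeasure_self]
      exact fun _ => ⟨fun _ h0 => by simp [this] at h0, fun _ h0 => by simp [this, h.left] at h0⟩
    | succ k ih =>
      intro hk
      obtain ⟨ih1, ih2⟩ := ih (by omega)
      have hk' : k < n := hk
      have hxk := h.mem_Icc hk'.le
      have hEk := hE1 k hk'.le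
      have hEk0 := hE0 k
      rw [hS1, hE2 k hk']
      have cross : ∀ {e f : ℝ}, 0 ≤ e → 0 ≤ f → t ∈ crossLevels u x k →
          e + f = 1 + (t - d k) / c k → (0 < f → g f ≤ S k) →
          g e ≤ S k + g (1 + (t - d k) / c k) := by
        intro e f he hf hm hef hfS
        have := h.Icc_subset hk' (Ioo_subset_Icc_self (h.crossing_mem_Ioo hk' hm))
        rcases hf.eq_or_lt with rfl | hf0
        · rw [← hef, add_zero]; linarith [hS0 k hk'.le]
        · have := hg e f he hf (by linarith [this.2])
          rw [← hef]; linarith [hfS hf0]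
      constructor
      · intro hr hpos
        rcases lt_or_gt_of_ne (ht k hk'.le) with hl | hl
        · have hnot : t ∉ crossLevels u x k :=
            fun hm => absurd hm.2 (not_lt.2 (by simp [hl.le, hr.le]))
          rw [h.superMeasure_of_gt_of_gt hk' hl hr] at hpos ⊢
          simpa [hnot] using ih1 hl (by simpa using hpos)
        · have hm : t ∈ crossLevels u x k := ⟨by simp [hr], by simp [hl]⟩
          rw [h.superMeasure_of_lt_of_gt hk' hl hr] at hpos ⊢
          rw [if_pos hm]
          exact cross hpos.le (by linarith) hm (by ring) (ih2 hl)
      · intro hr hpos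
        rcases lt_or_gt_of_ne (ht k hk'.le) with hl | hl
        · have hm : t ∈ crossLevels u x k := ⟨by simp [hl], by simp [hr]⟩
          rw [h.superMeasure_of_gt_of_lt hk' hl hr] at hpos ⊢
          rw [if_pos hm]
          exact cross hpos.le hEk0 hm (by ring) (ih1 hl)
        · have hnot : t ∉ crossLevels u x k :=
            fun hm => absurd hm.1 (not_lt.2 (by simp [hl.le, hr.le]))
          rw [h.superMeasure_of_lt_of_lt hk' hl hr] at hpos ⊢
          rw [show 1 + x (k + 1) - (E k + (x (k + 1) - x k)) = 1 + x k - E k by ring] at hpos ⊢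
          simpa [hnot] using ih2 hl hpos
  have hEn : distrib u t = E n := by simp only [distrib_eq_superMeasure, hE, h.right]
  obtain ⟨h1, h2⟩ := key n le_rfl
  rw [hEn] at hμ0 hμ2 ⊢
  rcases lt_or_gt_of_ne (ht n le_rfl) with hl | hl
  · exact h1 hl hμ0
  · rw [← hgsymm _ ⟨hμ0.le, hμ2.le⟩]
    have := h2 hl
    rw [h.right, show 1 + 1 - E n = 2 - E n by ring] at this
    exact this (by linarith)

open Classical in
lemma crossDensity_pos (h : AffinePieces u n x c d) {t : ℝ} (ht : ∀ i ≤ n, u (x i) ≠ t)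
    (hμ0 : 0 < distrib u t) (hμ2 : distrib u t < 2) : 0 < crossDensity u n x c t := by
  have := h.le_sum_crossing ht (g := fun _ => 1) (by simp) (by simp) (by norm_num) hμ0 hμ2
  obtain ⟨i, hi, hm⟩ : ∃ i ∈ Finset.range n, t ∈ crossLevels u x i := by
    by_contra! hcon
    rw [Finset.sum_congr rfl fun i hi => if_neg (hcon i hi)] at this
    norm_num at this
  refine Finset.sum_pos' (fun j _ => by positivity) ⟨i, hi, ?_⟩
  rw [if_pos hm]
  have := h.slope_ne_zero (Finset.mem_range.1 hi) hm
  positivity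

lemma _root_.mrear_eq {u : ℝ → ℝ} {y s : ℝ} (hy : y ≤ 1) (hs : 0 ≤ s)
    (h1 : ∀ r < s, 1 - y ≤ distrib u r) (h2 : ∀ r, s < r → distrib u r < 1 - y) :
    mrear u y = s := by
  have hae : ∀ᵐ t : ℝ, t ∈ Ioi (0 : ℝ) →
      (Icc (1 - (volume {y ∈ Icc (-1 : ℝ) 1 | u y > t}).toReal) 1).indicator
        (fun _ => (1 : ℝ)) y = (Iio s).indicator (fun _ => (1 : ℝ)) t := by
    filter_upwards [compl_mem_ae_iff.2 (measure_singleton s)] with t hts _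
    change (Icc (1 - distrib u t) 1).indicator _ y = _
    rcases lt_or_gt_of_ne (show t ≠ s from hts) with hlt | hgt
    · rw [indicator_of_mem (show y ∈ Icc (1 - distrib u t) 1 from
        ⟨by linarith [h1 t hlt], hy⟩), indicator_of_mem (show t ∈ Iio s from hlt)]
    · rw [indicator_of_notMem (show y ∉ Icc (1 - distrib u t) 1 from
        fun hm => by linarith [h2 t hgt, hm.1]), indicator_of_notMem (show t ∉ Iio s from not_lt.2 hgt.le)]
  rw [mrear, setIntegral_congr_ae measurableSet_Ioi hae, setIntegral_indicator measurableSet_Iio,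
    Ioi_inter_Iio]
  simp [hs]

/-- The measure of `{u ≥ t}` in `[-1,1]`. -/
def _root_.distribLE (u : ℝ → ℝ) (t : ℝ) : ℝ := (volume {y ∈ Icc (-1 : ℝ) 1 | t ≤ u y}).toReal

lemma _root_.distribLE_le_distrib (u : ℝ → ℝ) {s t : ℝ} (hst : s < t) :
    distribLE u t ≤ distrib u s :=
  ENNReal.toReal_mono (volume_sep_Icc_ne_top _)
    (measure_mono fun _ hy => ⟨hy.1, lt_of_lt_of_le hst hy.2⟩)

lemma _root_.distrib_le_of_forall_gt {u : ℝ → ℝ} {t b : ℝ} (hb : 0 ≤ b)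
    (hlt : ∀ s, t < s → distrib u s ≤ b) : distrib u t ≤ b := by
  have hU : {y ∈ Icc (-1 : ℝ) 1 | u y > t} =
      ⋃ k : ℕ, {y ∈ Icc (-1 : ℝ) 1 | u y > t + 1 / ((k : ℝ) + 1)} := by
    ext y
    simp only [mem_ofPred_eq, mem_iUnion]
    constructor
    · rintro ⟨hy, hty⟩
      obtain ⟨k, hk⟩ := exists_nat_one_div_lt (sub_pos.2 hty)
      exact ⟨k, hy, by linarith⟩
    · rintro ⟨k, hy, hty⟩
      have : (0 : ℝ) < 1 / ((k : ℝ) + 1) := by positivity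
      exact ⟨hy, by linarith⟩
  have hmono : Monotone fun k : ℕ => {y ∈ Icc (-1 : ℝ) 1 | u y > t + 1 / ((k : ℝ) + 1)} := by
    rintro k l hkl y ⟨hy, hty⟩
    refine ⟨hy, lt_of_le_of_lt ?_ hty⟩
    have := Nat.one_div_le_one_div (α := ℝ) hkl
    linarith
  refine ENNReal.toReal_le_of_le_ofReal hb ?_
  rw [hU, hmono.measure_iUnion]
  refine iSup_le fun k => ?_
  rw [← ENNReal.ofReal_toReal (volume_sep_Icc_ne_top _)]
  refine ENNReal.ofReal_le_ofReal (hlt _ ?_)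
  have : (0 : ℝ) < 1 / ((k : ℝ) + 1) := by positivity
  linarith

lemma le_distribLE_of_forall_lt (h : AffinePieces u n x c d) {t b : ℝ}
    (hlt : ∀ s < t, b ≤ distrib u s) : b ≤ distribLE u t := by
  have hU : {y ∈ Icc (-1 : ℝ) 1 | t ≤ u y} =
      ⋂ k : ℕ, {y ∈ Icc (-1 : ℝ) 1 | u y > t - 1 / ((k : ℝ) + 1)} := by
    ext y
    simp only [mem_ofPred_eq, mem_iInter]
    constructor
    · rintro ⟨hy, hty⟩ k
      have : (0 : ℝ) < 1 / ((k : ℝ) + 1) := by positivity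
      exact ⟨hy, by linarith⟩
    · intro hk
      refine ⟨(hk 0).1, not_lt.1 fun hty => ?_⟩
      obtain ⟨k, hk'⟩ := exists_nat_one_div_lt (sub_pos.2 hty)
      linarith [(hk k).2]
  have hanti : Antitone fun k : ℕ => {y ∈ Icc (-1 : ℝ) 1 | u y > t - 1 / ((k : ℝ) + 1)} := by
    rintro k l hkl y ⟨hy, hty⟩
    refine ⟨hy, lt_of_le_of_lt ?_ hty⟩
    have := Nat.one_div_le_one_div (α := ℝ) hkl
    linarith
  rw [distribLE, ← ENNReal.ofReal_le_iff_le_toReal (volume_sep_Icc_ne_top _), hU,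
    hanti.measure_iInter (fun k => (h.measurableSet_sep measurableSet_Ioi).nullMeasurableSet)
      ⟨0, volume_sep_Icc_ne_top _⟩]
  refine le_iInf fun k => ?_
  rw [ENNReal.ofReal_le_iff_le_toReal (volume_sep_Icc_ne_top _)]
  refine hlt _ ?_
  have : (0 : ℝ) < 1 / ((k : ℝ) + 1) := by positivity
  linarith

lemma distribLE_eq (h : AffinePieces u n x c d) (t : ℝ) :
    distribLE u t = distrib u t + (volume {y ∈ Icc (-1 : ℝ) 1 | u y = t}).toReal := by
  have hU : {y ∈ Icc (-1 : ℝ) 1 | t ≤ u y} =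
      {y ∈ Icc (-1 : ℝ) 1 | u y > t} ∪ {y ∈ Icc (-1 : ℝ) 1 | u y = t} := by
    ext y
    simp only [mem_ofPred_eq, mem_union, le_iff_lt_or_eq (a := t), eq_comm (a := t), gt_iff_lt]
    tauto
  have hm : MeasurableSet {y ∈ Icc (-1 : ℝ) 1 | u y = t} :=
    h.measurableSet_sep (measurableSet_singleton t)
  rw [distribLE, hU, measure_union _ hm,
    ENNReal.toReal_add (volume_sep_Icc_ne_top _) (volume_sep_Icc_ne_top _), distrib]
  rw [Set.disjoint_left]
  rintro y ⟨_, h1⟩ ⟨_, h2⟩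
  exact h1.ne' h2

/-- The end point values of the pieces of `u`, together with `0`. -/
def _root_.nodeValues (u : ℝ → ℝ) (n : ℕ) (x : ℕ → ℝ) : Finset ℝ :=
  insert 0 ((Finset.range (n + 1)).image fun i => u (x i))

lemma _root_.ne_of_notMem_nodeValues {u : ℝ → ℝ} {n : ℕ} {x : ℕ → ℝ} {t : ℝ}
    (ht : t ∉ nodeValues u n x) : ∀ i ≤ n, u (x i) ≠ t := by
  rintro i hi rfl
  exact ht (Finset.mem_insert_of_mem
    (Finset.mem_image_of_mem (fun i => u (x i)) (Finset.mem_range.2 (by omega))))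

lemma nonneg_of_mem_nodeValues (h : AffinePieces u n x c d) (hnn : ∀ y ∈ Icc (-1 : ℝ) 1, 0 ≤ u y)
    {v : ℝ} (hv : v ∈ nodeValues u n x) : 0 ≤ v := by
  rcases Finset.mem_insert.1 hv with rfl | hv
  · exact le_rfl
  · obtain ⟨i, hi, rfl⟩ := Finset.mem_image.1 hv
    exact hnn _ (h.mem_Icc (by simpa [Nat.lt_succ_iff] using hi))

/-- The levels, other than node values, which `u` attains transversally. -/
def _root_.regularLevels (u : ℝ → ℝ) (n : ℕ) (x : ℕ → ℝ) : Set ℝ :=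
  {t | t ∉ nodeValues u n x ∧ 0 < distrib u t ∧ distrib u t < 2}

lemma _root_.measurableSet_regularLevels (u : ℝ → ℝ) (n : ℕ) (x : ℕ → ℝ) :
    MeasurableSet (regularLevels u n x) := by
  have hm : Measurable (distrib u) := (distrib_antitone u).measurable
  exact ((nodeValues u n x).measurableSet.compl).inter
    ((measurableSet_lt measurable_const hm).inter (measurableSet_lt hm measurable_const))

lemma _root_.distrib_eq_two_of_neg {u : ℝ → ℝ} (hnn : ∀ y ∈ Icc (-1 : ℝ) 1, 0 ≤ u y) {t : ℝ}
    (ht : t < 0) : distrib u t = 2 := by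
  have : {y ∈ Icc (-1 : ℝ) 1 | u y > t} = Icc (-1 : ℝ) 1 :=
    sep_eq_self_iff_mem_true.2 fun y hy => ht.trans_le (hnn y hy)
  rw [distrib, this, Real.volume_Icc, ENNReal.toReal_ofReal] <;> norm_num

lemma _root_.pos_of_mem_regularLevels {u : ℝ → ℝ} {n : ℕ} {x : ℕ → ℝ}
    (hnn : ∀ y ∈ Icc (-1 : ℝ) 1, 0 ≤ u y) {t : ℝ} (ht : t ∈ regularLevels u n x) : 0 < t := by
  refine lt_of_le_of_ne (not_lt.1 fun h0 => ht.2.2.ne (distrib_eq_two_of_neg hnn h0)) ?_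
  rintro rfl
  exact ht.1 (Finset.mem_insert_self _ _)

lemma crossDensity_pos_of_mem (h : AffinePieces u n x c d) {t : ℝ}
    (ht : t ∈ regularLevels u n x) : 0 < crossDensity u n x c t :=
  h.crossDensity_pos (ne_of_notMem_nodeValues ht.1) ht.2.1 ht.2.2

lemma eventually_mrear (h : AffinePieces u n x c d) (hnn : ∀ y ∈ Icc (-1 : ℝ) 1, 0 ≤ u y) {t : ℝ}
    (ht : t ∈ regularLevels u n x) :
    ∀ᶠ y in nhds (1 - distrib u t),
      mrear u y = t + (y - (1 - distrib u t)) / crossDensity u n x c t := by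
  have hB := h.crossDensity_pos_of_mem ht
  set B := crossDensity u n x c t
  have hL : Tendsto (fun y => t + (y - (1 - distrib u t)) / B) (nhds (1 - distrib u t))
      (nhds t) := by
    have : Continuous fun y => t + (y - (1 - distrib u t)) / B := by fun_prop
    simpa using this.tendsto (1 - distrib u t)
  have hev := hL.eventually ((eventually_eventually_nhds.2
    (h.eventually_distrib (ne_of_notMem_nodeValues ht.1))).and
    (lt_mem_nhds (pos_of_mem_regularLevels hnn ht)))
  filter_upwards [hev] with y hy
  obtain ⟨hy1, hy0⟩ := hy
  set s := t + (y - (1 - distrib u t)) / B with hs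
  have hys : distrib u s = 1 - y := by
    rw [hy1.self_of_nhds, hs]
    field_simp
    ring
  refine mrear_eq (by linarith [distrib_nonneg u s]) hy0.le
    (fun r hr => hys ▸ distrib_antitone u hr.le) fun r hr => ?_
  obtain ⟨r', hq1, hq2⟩ :=
    ((hy1.filter_mono nhdsWithin_le_nhds).and (Ioo_mem_nhdsGT hr)).exists
  rw [← hys]
  refine (distrib_antitone u hq2.2.le).trans_lt ?_
  rw [hq1, hy1.self_of_nhds]
  have := mul_lt_mul_of_pos_left hq2.1 hB
  linarith

lemma mrear_eq_of_mem_plateau {v : ℝ} (hv : 0 ≤ v) {y : ℝ}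
    (hy : y ∈ Ioo (1 - distribLE u v) (1 - distrib u v)) : mrear u y = v :=
  mrear_eq (by linarith [hy.2, distrib_nonneg u v]) hv
    (fun r hr => by linarith [hy.1, distribLE_le_distrib u hr])
    (fun r hr => by linarith [hy.2, distrib_antitone u hr.le])

lemma distrib_eq_zero (h : AffinePieces u n x c d) {t : ℝ} (ht : ∀ i ≤ n, u (x i) < t) :
    distrib u t = 0 := by
  rw [h.distrib_eq_sum]
  refine Finset.sum_eq_zero fun i hi => ?_
  have hi' := Finset.mem_range.1 hi
  exact h.superMeasure_of_gt_of_gt hi' (ht i hi'.le) (ht (i + 1) hi')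

lemma Icc_subset_regular_union_plateaus (h : AffinePieces u n x c d)
    (hnn : ∀ y ∈ Icc (-1 : ℝ) 1, 0 ≤ u y) :
    Icc (-1 : ℝ) 1 ⊆ ({-1, 1} ∪ (fun t => 1 - distrib u t) '' regularLevels u n x) ∪
      ⋃ v ∈ nodeValues u n x, Icc (1 - distribLE u v) (1 - distrib u v) := by
  intro y hy
  by_cases hend : y = -1 ∨ y = 1
  · exact Or.inl (Or.inl hend)
  have hy1 : y < 1 := lt_of_le_of_ne hy.2 fun h0 => hend (Or.inr h0)
  have hy2 : -1 < y := lt_of_le_of_ne hy.1 fun h0 => hend (Or.inl h0.symm)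
  set S := {s | 1 - y ≤ distrib u s} with hS
  have hneg : ∀ s < 0, s ∈ S := fun s hs => by
    change 1 - y ≤ distrib u s
    rw [distrib_eq_two_of_neg hnn hs]; linarith
  have hbdd : BddAbove S := by
    obtain ⟨M, hM⟩ := (nodeValues u n x).bddAbove
    refine ⟨M + 1, fun s hs => ?_⟩
    by_contra! hlt
    have h0 := h.distrib_eq_zero (t := s) fun i hi => by
      have := hM (Finset.mem_coe.2 (Finset.mem_insert_of_mem
        (Finset.mem_image_of_mem (fun i => u (x i)) (Finset.mem_range.2 (by omega : i < n + 1)))))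
      linarith
    have hs' : 1 - y ≤ distrib u s := hs
    linarith
  have hne : S.Nonempty := ⟨-1, hneg _ (by norm_num)⟩
  have hgt : ∀ s, sSup S < s → distrib u s < 1 - y := fun s hs =>
    not_le.1 fun hcon => absurd (le_csSup hbdd hcon) (not_le.2 hs)
  have hlt : ∀ s < sSup S, 1 - y ≤ distrib u s := fun s hs => by
    obtain ⟨r, hr, hsr⟩ := exists_lt_of_lt_csSup hne hs
    exact le_trans hr (distrib_antitone u hsr.le)
  by_cases hV : sSup S ∈ nodeValues u n x
  · refine Or.inr (mem_biUnion hV ⟨?_, ?_⟩)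
    · linarith [h.le_distribLE_of_forall_lt hlt]
    · linarith [distrib_le_of_forall_gt (by linarith) fun s hs => (hgt s hs).le]
  · have hcont : Tendsto (distrib u) (nhds (sSup S)) (nhds (distrib u (sSup S))) := by
      have hlin : Continuous fun s =>
        distrib u (sSup S) - crossDensity u n x c (sSup S) * (s - sSup S) := by fun_prop
      refine Tendsto.congr'
        ((h.eventually_distrib (ne_of_notMem_nodeValues hV)).mono fun s hs => hs.symm) ?_
      simpa using hlin.tendsto (sSup S)
    have h1 : distrib u (sSup S) ≤ 1 - y :=
      distrib_le_of_forall_gt (by linarith) fun s hs => (hgt s hs).le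
    have h2 : 1 - y ≤ distrib u (sSup S) :=
      ge_of_tendsto (hcont.mono_left (nhdsWithin_le_nhds (s := Iio (sSup S))))
        (eventually_mem_nhdsWithin.mono hlt)
    refine Or.inl (Or.inr ⟨sSup S, ⟨hV, ?_, ?_⟩, ?_⟩)
    · linarith
    · linarith
    · simp only; linarith

lemma volume_plateau (h : AffinePieces u n x c d) (v : ℝ) :
    volume (Icc (1 - distribLE u v) (1 - distrib u v)) =
      volume {y ∈ Icc (-1 : ℝ) 1 | u y = v} := by
  rw [Real.volume_Icc, h.distribLE_eq, show ∀ p q : ℝ, 1 - p - (1 - (p + q)) = q by intros; ring,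
    ENNReal.ofReal_toReal (volume_sep_Icc_ne_top _)]

lemma lintegral_plateau (h : AffinePieces u n x c d) (F a : ℝ → ℝ → ℝ) {v : ℝ} (hv : 0 ≤ v) :
    ∫⁻ y in Icc (1 - distribLE u v) (1 - distrib u v),
      ENNReal.ofReal (F (mrear u y) (a y (mrear u y) * |deriv (mrear u) y|)) =
    ENNReal.ofReal (F v 0) * volume {y ∈ Icc (-1 : ℝ) 1 | u y = v} := by
  rw [← h.volume_plateau, ← setLIntegral_congr Ioo_ae_eq_Icc, ← measure_congr Ioo_ae_eq_Icc,
    ← setLIntegral_const]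
  refine setLIntegral_congr_fun measurableSet_Ioo fun y hy => ?_
  have hd : deriv (mrear u) y = 0 := by
    have : mrear u =ᶠ[nhds y] fun _ => v := by
      filter_upwards [isOpen_Ioo.mem_nhds hy] with z hz
      exact mrear_eq_of_mem_plateau hv hz
    rw [this.deriv_eq, deriv_const]
  simp [hd, mrear_eq_of_mem_plateau hv hy]

lemma mrear_one_sub_distrib (h : AffinePieces u n x c d) (hnn : ∀ y ∈ Icc (-1 : ℝ) 1, 0 ≤ u y)
    {t : ℝ} (ht : t ∈ regularLevels u n x) : mrear u (1 - distrib u t) = t := by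
  simpa using (h.eventually_mrear hnn ht).self_of_nhds

lemma deriv_mrear (h : AffinePieces u n x c d) (hnn : ∀ y ∈ Icc (-1 : ℝ) 1, 0 ≤ u y)
    {t : ℝ} (ht : t ∈ regularLevels u n x) :
    deriv (mrear u) (1 - distrib u t) = (crossDensity u n x c t)⁻¹ := by
  rw [Filter.EventuallyEq.deriv_eq (h.eventually_mrear hnn ht)]
  simp

lemma hasDerivAt_one_sub_distrib (h : AffinePieces u n x c d) {t : ℝ}
    (ht : ∀ i ≤ n, u (x i) ≠ t) :
    HasDerivAt (fun s => 1 - distrib u s) (crossDensity u n x c t) t := by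
  have hl : HasDerivAt (fun s => 1 - (distrib u t - crossDensity u n x c t * (s - t)))
      (-(-(crossDensity u n x c t * 1))) t :=
    ((((hasDerivAt_id t).sub_const t).const_mul _).const_sub _).const_sub _
  simp only [mul_one, neg_neg] at hl
  exact hl.congr_of_eventuallyEq ((h.eventually_distrib ht).mono fun s hs => by simp only [hs])

lemma lintegral_image_regularLevels (h : AffinePieces u n x c d)
    (hnn : ∀ y ∈ Icc (-1 : ℝ) 1, 0 ≤ u y) (F a : ℝ → ℝ → ℝ) :
    ∫⁻ y in (fun t => 1 - distrib u t) '' regularLevels u n x,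
      ENNReal.ofReal (F (mrear u y) (a y (mrear u y) * |deriv (mrear u) y|)) =
    ∫⁻ t in regularLevels u n x, ENNReal.ofReal (crossDensity u n x c t *
      F t (a (1 - distrib u t) t * (crossDensity u n x c t)⁻¹)) := by
  rw [lintegral_image_eq_lintegral_abs_deriv_mul (measurableSet_regularLevels u n x)
    (fun t ht => (h.hasDerivAt_one_sub_distrib (ne_of_notMem_nodeValues ht.1)).hasDerivWithinAt)
    (LeftInvOn.injOn (f₁' := mrear u) fun t ht => h.mrear_one_sub_distrib hnn ht)]
  refine setLIntegral_congr_fun (measurableSet_regularLevels u n x) fun t ht => ?_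
  have hB := h.crossDensity_pos_of_mem ht
  simp only [h.mrear_one_sub_distrib hnn ht, h.deriv_mrear hnn ht, abs_of_pos hB, abs_inv]
  rw [ENNReal.ofReal_mul hB.le]

lemma _root_.lintegral_biUnion_finset_le {ι : Type*} (s : Finset ι) (t : ι → Set ℝ)
    (f : ℝ → ℝ≥0∞) : ∫⁻ y in ⋃ i ∈ s, t i, f y ≤ ∑ i ∈ s, ∫⁻ y in t i, f y := by
  classical
  induction s using Finset.induction_on with
  | empty => simp
  | insert i s hi ih =>
    rw [Finset.set_biUnion_insert, Finset.sum_insert hi]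
    exact (lintegral_union_le _ _ _).trans (add_le_add le_rfl ih)

lemma Ifun_mrear_le (h : AffinePieces u n x c d)
    (hnn : ∀ y ∈ Icc (-1 : ℝ) 1, 0 ≤ u y) (F a : ℝ → ℝ → ℝ) :
    Ifun F a (mrear u) ≤
      (∫⁻ t in regularLevels u n x, ENNReal.ofReal (crossDensity u n x c t *
        F t (a (1 - distrib u t) t * (crossDensity u n x c t)⁻¹))) +
      ∑ v ∈ nodeValues u n x,
        ENNReal.ofReal (F v 0) * volume {y ∈ Icc (-1 : ℝ) 1 | u y = v} := by
  rw [Ifun, ← h.lintegral_image_regularLevels hnn, ← Finset.sum_congr rfl fun v hv =>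
    h.lintegral_plateau F a (h.nonneg_of_mem_nodeValues hnn hv)]
  refine (lintegral_mono_set (h.Icc_subset_regular_union_plateaus hnn)).trans ?_
  refine (lintegral_union_le _ _ _).trans (add_le_add ?_ (lintegral_biUnion_finset_le _ _ _))
  refine (lintegral_union_le _ _ _).trans_eq ?_
  rw [setLIntegral_measure_zero _ _ ((toFinite _).measure_zero _), zero_add]

lemma regularLevels_jensen (h : AffinePieces u n x c d)
    {a F : ℝ → ℝ → ℝ} (ha : Weight a)
    (heven : ∀ x v : ℝ, x ∈ Icc (-1 : ℝ) 1 → 0 ≤ v → a x v = a (-x) v)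
    (hC : CondC a) (hF : MemFrakF F) {t : ℝ} (ht0 : 0 ≤ t) (ht : t ∈ regularLevels u n x) :
    ENNReal.ofReal (crossDensity u n x c t *
      F t (a (1 - distrib u t) t * (crossDensity u n x c t)⁻¹)) ≤
    ∑ i ∈ Finset.range n, (crossLevels u x i).indicator
      (fun t => ENNReal.ofReal (|c i|⁻¹ * F t (a ((t - d i) / c i) t * |c i|))) t := by
  classical
  have hB := h.crossDensity_pos_of_mem ht
  set B := crossDensity u n x c t with hBdef
  set s := (Finset.range n).filter fun i => t ∈ crossLevels u x i with hs
  have hmem : ∀ i ∈ s, i < n ∧ t ∈ crossLevels u x i := fun i hi => by simpa [hs] using hi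
  have hpI : ∀ i ∈ s, (t - d i) / c i ∈ Icc (-1 : ℝ) 1 := fun i hi =>
    h.Icc_subset (hmem i hi).1
      (Ioo_subset_Icc_self (h.crossing_mem_Ioo (hmem i hi).1 (hmem i hi).2))
  have hc : ∀ i ∈ s, 0 < |c i| := fun i hi =>
    abs_pos.2 (h.slope_ne_zero (hmem i hi).1 (hmem i hi).2)
  have ha0 : ∀ i ∈ s, 0 ≤ a ((t - d i) / c i) t := fun i hi => ha.2 _ _ (hpI i hi) ht0
  have hBs : ∑ i ∈ s, |c i|⁻¹ = B := by rw [hs, Finset.sum_filter, hBdef, crossDensity]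
  have hsum : a (1 - distrib u t) t ≤ ∑ i ∈ s, a ((t - d i) / c i) t := by
    have key := h.le_sum_crossing (ne_of_notMem_nodeValues ht.1) (g := fun l => a (1 - l) t)
      (fun l hl => ha.2 _ _ ⟨by linarith [hl.2], by linarith [hl.1]⟩ ht0)
      (fun l hl => by
        rw [heven (1 - l) t ⟨by linarith [hl.2], by linarith [hl.1]⟩ ht0]
        congr 1; ring)
      (fun l m hl hm hlm => by
        have h1 := hC (l - 1) (1 - m) t (by linarith) (by linarith) (by linarith) ht0
        rw [heven (l - 1) t ⟨by linarith, by linarith⟩ ht0,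
          heven (1 - (1 - m) + (l - 1)) t ⟨by linarith, by linarith⟩ ht0] at h1
        convert h1 using 2 <;> ring_nf)
      ht.2.1 ht.2.2
    refine key.trans_eq ?_
    rw [← Finset.sum_filter]
    refine Finset.sum_congr rfl fun i hi => ?_
    rw [heven _ _ (hpI i hi) ht0]
    congr 1; ring
  have hreal : B * F t (a (1 - distrib u t) t * B⁻¹) ≤
      ∑ i ∈ s, |c i|⁻¹ * F t (a ((t - d i) / c i) t * |c i|) := by
    have hj := (hF.2.2.1 t ht0).map_sum_le (t := s) (w := fun i => |c i|⁻¹ / B)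
      (p := fun i => a ((t - d i) / c i) t * |c i|)
      (fun i _ => by positivity) (by rw [← Finset.sum_div, hBs, div_self hB.ne'])
      (fun i hi => mul_nonneg (ha0 i hi) (abs_nonneg _))
    simp only [smul_eq_mul] at hj
    have hp : ∑ i ∈ s, |c i|⁻¹ / B * (a ((t - d i) / c i) t * |c i|) =
        (∑ i ∈ s, a ((t - d i) / c i) t) * B⁻¹ := by
      rw [Finset.sum_mul]
      refine Finset.sum_congr rfl fun i hi => ?_
      have := (hc i hi).ne'
      field_simp
    rw [hp] at hj
    have hI : 1 - distrib u t ∈ Icc (-1 : ℝ) 1 :=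
      ⟨by linarith [ht.2.2], by linarith [ht.2.1]⟩
    have hmono := hF.2.2.2 t ht0 (mul_nonneg (ha.2 _ _ hI ht0) (inv_nonneg.2 hB.le))
      (mul_nonneg (Finset.sum_nonneg ha0) (inv_nonneg.2 hB.le))
      (mul_le_mul_of_nonneg_right hsum (inv_nonneg.2 hB.le))
    refine (mul_le_mul_of_nonneg_left (hmono.trans hj) hB.le).trans_eq ?_
    rw [Finset.mul_sum]
    refine Finset.sum_congr rfl fun i _ => ?_
    field_simp
  refine (ENNReal.ofReal_le_ofReal hreal).trans_eq ?_
  rw [ENNReal.ofReal_sum_of_nonneg, hs, Finset.sum_filter]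
  · rfl
  · exact fun i hi => mul_nonneg (by positivity)
      (hF.2.1 _ _ ht0 (mul_nonneg (ha0 i hi) (abs_nonneg _)))

lemma aemeasurable_crossing (h : AffinePieces u n x c d)
    (hnn : ∀ y ∈ Icc (-1 : ℝ) 1, 0 ≤ u y) {a F : ℝ → ℝ → ℝ} (ha : Weight a) (hF : MemFrakF F)
    {i : ℕ} (hi : i < n) :
    AEMeasurable (fun t => ENNReal.ofReal (|c i|⁻¹ * F t (a ((t - d i) / c i) t * |c i|)))
      (volume.restrict (crossLevels u x i ∩ regularLevels u n x)) := by
  have hm : MeasurableSet (crossLevels u x i ∩ regularLevels u n x) :=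
    measurableSet_Ioo.inter (measurableSet_regularLevels u n x)
  refine (ContinuousOn.aemeasurable (f := fun t => |c i|⁻¹ * F t (a ((t - d i) / c i) t * |c i|))
    ?_ hm).ennreal_ofReal
  have hpI : ∀ t ∈ crossLevels u x i ∩ regularLevels u n x,
      ((t - d i) / c i, t) ∈ Icc (-1 : ℝ) 1 ×ˢ Ici (0 : ℝ) := fun t ht =>
    ⟨h.Icc_subset hi (Ioo_subset_Icc_self (h.crossing_mem_Ioo hi ht.1)),
      (pos_of_mem_regularLevels hnn ht.2).le⟩
  have h1 : ContinuousOn (fun t => a ((t - d i) / c i) t)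
      (crossLevels u x i ∩ regularLevels u n x) :=
    ha.1.comp (f := fun t => ((t - d i) / c i, t)) (by fun_prop) hpI
  have h2 : ContinuousOn (fun t => F t (a ((t - d i) / c i) t * |c i|))
      (crossLevels u x i ∩ regularLevels u n x) :=
    hF.1.comp (f := fun t => (t, a ((t - d i) / c i) t * |c i|))
      (continuousOn_id.prodMk (h1.mul continuousOn_const))
      fun t ht => ⟨(hpI t ht).2, mul_nonneg (ha.2 _ _ (hpI t ht).1 (hpI t ht).2) (abs_nonneg _)⟩
  exact continuousOn_const.mul h2

lemma deriv_crossing (h : AffinePieces u n x c d) {i : ℕ} (hi : i < n) {t : ℝ}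
    (ht : t ∈ crossLevels u x i) : deriv u ((t - d i) / c i) = c i := by
  have : u =ᶠ[nhds ((t - d i) / c i)] fun y => c i * y + d i := by
    filter_upwards [isOpen_Ioo.mem_nhds (h.crossing_mem_Ioo hi ht)] with y hy
    exact h.eq i hi y (Ioo_subset_Icc_self hy)
  rw [this.deriv_eq]
  simp

lemma injOn_crossing (h : AffinePieces u n x c d) {i : ℕ} (hi : i < n) :
    InjOn (fun t => (t - d i) / c i) (crossLevels u x i) :=
  LeftInvOn.injOn (f₁' := u) fun _ ht => h.apply_crossing hi ht

lemma lintegral_crossing (h : AffinePieces u n x c d) (F a : ℝ → ℝ → ℝ) {i : ℕ} (hi : i < n) :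
    ∫⁻ y in (fun t => (t - d i) / c i) '' (crossLevels u x i ∩ regularLevels u n x),
      ENNReal.ofReal (F (u y) (a y (u y) * |deriv u y|)) =
    ∫⁻ t in crossLevels u x i ∩ regularLevels u n x,
      ENNReal.ofReal (|c i|⁻¹ * F t (a ((t - d i) / c i) t * |c i|)) := by
  have hm : MeasurableSet (crossLevels u x i ∩ regularLevels u n x) :=
    measurableSet_Ioo.inter (measurableSet_regularLevels u n x)
  rw [lintegral_image_eq_lintegral_abs_deriv_mul (f := fun t => (t - d i) / c i) hm
    (fun t _ => (((hasDerivAt_id t).sub_const (d i)).div_const (c i)).hasDerivWithinAt)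
    ((h.injOn_crossing hi).mono inter_subset_left)]
  refine setLIntegral_congr_fun hm fun t ht => ?_
  simp only [h.apply_crossing hi ht.1, h.deriv_crossing hi ht.1, one_div, abs_inv]
  rw [ENNReal.ofReal_mul (by positivity)]

lemma le_Ifun (h : AffinePieces u n x c d)
    (hnn : ∀ y ∈ Icc (-1 : ℝ) 1, 0 ≤ u y) {a F : ℝ → ℝ → ℝ} (ha : Weight a) (hF : MemFrakF F) :
    (∑ i ∈ Finset.range n, ∫⁻ t in crossLevels u x i ∩ regularLevels u n x,
      ENNReal.ofReal (|c i|⁻¹ * F t (a ((t - d i) / c i) t * |c i|))) +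
    ∑ v ∈ nodeValues u n x,
      ENNReal.ofReal (F v 0) * volume {y ∈ Icc (-1 : ℝ) 1 | u y = v} ≤ Ifun F a u := by
  set f : ℝ → ℝ≥0∞ := fun y => ENNReal.ofReal (F (u y) (a y (u y) * |deriv u y|)) with hf
  set C : ℕ → Set ℝ := fun i =>
    (fun t => (t - d i) / c i) '' (crossLevels u x i ∩ regularLevels u n x) with hCdef
  have hlev : ∀ v, MeasurableSet {y ∈ Icc (-1 : ℝ) 1 | u y = v} := fun v =>
    h.measurableSet_sep (measurableSet_singleton v)
  have hCm : ∀ i ∈ Finset.range n, MeasurableSet (C i) := fun i hi =>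
    (measurableSet_Ioo.inter (measurableSet_regularLevels u n x)).image_of_continuousOn_injOn
      (by fun_prop) ((h.injOn_crossing (Finset.mem_range.1 hi)).mono inter_subset_left)
  have hCI : ∀ i < n, C i ⊆ Ioo (x i) (x (i + 1)) := by
    rintro i hi _ ⟨t, ht, rfl⟩
    exact h.crossing_mem_Ioo hi ht.1
  have hCd : (↑(Finset.range n) : Set ℕ).PairwiseDisjoint C := by
    have aux : ∀ i < n, ∀ j < n, i < j → Disjoint (C i) (C j) := fun i hi j hj hij => by
      refine (Set.disjoint_left.2 fun y hy hy' => ?_)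
      have := h.le_of_le (Nat.succ_le_of_lt hij) hj.le
      exact absurd ((hCI i hi hy).2.trans_le this) (not_lt.2 (hCI j hj hy').1.le)
    intro i hi j hj hij
    have hi' : i < n := by simpa using hi
    have hj' : j < n := by simpa using hj
    rcases lt_or_gt_of_ne hij with hlt | hlt
    · exact aux i hi' j hj' hlt
    · exact (aux j hj' i hi' hlt).symm
  have hLd : (↑(nodeValues u n x) : Set ℝ).PairwiseDisjoint
      fun v => {y ∈ Icc (-1 : ℝ) 1 | u y = v} := by
    intro v _ w _ hvw
    exact Set.disjoint_left.2 fun y hy hy' => hvw (hy.2.symm.trans hy'.2)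
  have h1 : (∑ i ∈ Finset.range n, ∫⁻ t in crossLevels u x i ∩ regularLevels u n x,
      ENNReal.ofReal (|c i|⁻¹ * F t (a ((t - d i) / c i) t * |c i|))) =
      ∫⁻ y in ⋃ i ∈ Finset.range n, C i, f y := by
    rw [lintegral_biUnion_finset hCd hCm]
    exact Finset.sum_congr rfl fun i hi =>
      (h.lintegral_crossing F a (Finset.mem_range.1 hi)).symm
  have h2 : ∑ v ∈ nodeValues u n x,
      ENNReal.ofReal (F v 0) * volume {y ∈ Icc (-1 : ℝ) 1 | u y = v} ≤
      ∫⁻ y in ⋃ v ∈ nodeValues u n x, {y ∈ Icc (-1 : ℝ) 1 | u y = v}, f y := by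
    rw [lintegral_biUnion_finset hLd fun v _ => hlev v]
    refine Finset.sum_le_sum fun v hv => ?_
    rw [← setLIntegral_const]
    refine setLIntegral_mono' (hlev v) ?_
    rintro y ⟨hy, rfl⟩
    have hp : 0 ≤ a y (u y) * |deriv u y| := mul_nonneg (ha.2 _ _ hy (hnn y hy)) (abs_nonneg _)
    exact ENNReal.ofReal_le_ofReal (hF.2.2.2 _ (hnn y hy) self_mem_Ici hp hp)
  rw [h1]
  refine (add_le_add le_rfl h2).trans ?_
  rw [← lintegral_union (Finset.measurableSet_biUnion _ fun v _ => hlev v)]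
  · refine lintegral_mono_set (union_subset (iUnion₂_subset fun i hi => ?_)
      (iUnion₂_subset fun v _ => sep_subset _ _))
    have hi' := Finset.mem_range.1 hi
    exact (hCI i hi').trans (Ioo_subset_Icc_self.trans (h.Icc_subset hi'))
  · refine Set.disjoint_left.2 fun y hy hy' => ?_
    simp only [mem_iUnion, hCdef] at hy hy'
    obtain ⟨i, hi, t, ht, rfl⟩ := hy
    obtain ⟨v, hv, _, huv⟩ := hy'
    rw [h.apply_crossing (Finset.mem_range.1 hi) ht.1] at huv
    exact ht.2.1 (huv ▸ hv)

end AffinePieces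

/-- `I(a,u*) ≤ I(a,u)` for nonnegative piecewise linear `u`,
for an even weight satisfying condition (C). -/
theorem stmt8 (a F : ℝ → ℝ → ℝ) (ha : Weight a)
    (heven : ∀ x v : ℝ, x ∈ Icc (-1 : ℝ) 1 → 0 ≤ v → a x v = a (-x) v)
    (hC : CondC a) (hF : MemFrakF F)
    (u : ℝ → ℝ) (hu : PiecewiseLinear u) (hnn : ∀ x ∈ Icc (-1 : ℝ) 1, 0 ≤ u x) :
    Ifun F a (mrear u) ≤ Ifun F a u := by
  obtain ⟨n, x, c, d, h⟩ := hu.exists_affinePieces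
  refine (h.Ifun_mrear_le hnn F a).trans (le_trans (add_le_add ?_ le_rfl) (h.le_Ifun hnn ha hF))
  refine (setLIntegral_mono' (measurableSet_regularLevels u n x) fun t ht =>
    h.regularLevels_jensen ha heven hC hF (pos_of_mem_regularLevels hnn ht).le ht).trans_eq ?_
  rw [lintegral_finsetSum']
  · refine Finset.sum_congr rfl fun i _ => ?_
    rw [lintegral_indicator (by exact measurableSet_Ioo),
      Measure.restrict_restrict (by exact measurableSet_Ioo)]
  · intro i hi
    rw [aemeasurable_indicator_iff (by exact measurableSet_Ioo),
      Measure.restrict_restrict (by exact measurableSet_Ioo)]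
    exact h.aemeasurable_crossing hnn ha hF (Finset.mem_range.1 hi)
end
end

section
/- Let a : [-1,1] × [0,∞) → [0,∞) be continuous and F ∈ 𝔉. Then the functional u ↦ I(a,u) is weakly lower semicontinuous on nonnegative functions in W¹₁(-1,1): if u_m, u ∈ W¹₁(-1,1) are nonnegative and u_m ⇀ u weakly in W¹₁(-1,1), then I(a,u) ≤ liminf_{m→∞} I(a,u_m). -/
open MeasureTheory Set Filter
open scoped ENNReal BigOperators NNReal

noncomputable section

theorem exists_integral_abs_le_of_weakly_null {α : Type*} [MeasurableSpace α] {μ : Measure α}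
    [IsFiniteMeasure μ] {e : ℕ → α → ℝ} (hem : ∀ m, Measurable (e m))
    (he : ∀ m, Integrable (e m) μ)
    (hweak : ∀ g : α → ℝ, Measurable g → (∃ C : ℝ, ∀ x, |g x| ≤ C) →
      Tendsto (fun m => ∫ x, e m x * g x ∂μ) atTop (nhds 0)) :
    ∃ C, 0 ≤ C ∧ ∀ m, ∫ x, |e m x| ∂μ ≤ C := by
  let T : ℕ → Lp ℝ ∞ μ →L[ℝ] ℝ := fun m =>
    (ContinuousLinearMap.mul ℝ ℝ).lpPairing μ 1 ∞ ((memLp_one_iff_integrable.2 (he m)).toLp (e m))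
  have hT : ∀ m (g : Lp ℝ ∞ μ), T m g = ∫ x, e m x * g x ∂μ := by
    intro m g
    simp only [T, ContinuousLinearMap.lpPairing_eq_integral]
    refine integral_congr_ae ?_
    filter_upwards [(memLp_one_iff_integrable.2 (he m)).coeFn_toLp] with x hx
    simp [hx]
  obtain ⟨C, hC⟩ := banach_steinhaus (g := T) (by
    intro g
    have hb : ∀ᵐ x ∂μ, |g x| ≤ ‖g‖ := by
      have := ae_le_eLpNormEssSup (f := g) (μ := μ)
      filter_upwards [this] with x hx
      rw [Lp.norm_def, eLpNorm_exponent_top, ← Real.norm_eq_abs, ← toReal_enorm]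
      exact ENNReal.toReal_mono (by simpa using (Lp.eLpNorm_ne_top g)) hx
    have hlim : Tendsto (fun m => T m g) atTop (nhds 0) := by
      have := hweak (fun x => max (-‖g‖) (min (g x) ‖g‖))
        (measurable_const.max ((Lp.stronglyMeasurable g).measurable.min measurable_const))
        ⟨‖g‖, fun x => abs_le.2 ⟨le_max_left _ _, max_le (by linarith [norm_nonneg g])
          (min_le_right _ _)⟩⟩
      refine this.congr fun m => ?_
      rw [hT]
      refine integral_congr_ae ?_
      filter_upwards [hb] with x hx
      rw [min_eq_left (abs_le.1 hx).2, max_eq_right (abs_le.1 hx).1]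
    obtain ⟨C, hC⟩ := hlim.norm.bddAbove_range
    exact ⟨C, fun i => hC ⟨i, rfl⟩⟩)
  have hC0 : 0 ≤ C := (norm_nonneg _).trans (hC 0)
  set K : ℝ := (measureUnivNNReal μ : ℝ) ^ (∞ : ℝ≥0∞).toReal⁻¹ * 1 with hK
  have hK0 : 0 ≤ K := by positivity
  refine ⟨C * K, by positivity, fun m => ?_⟩
  let s : α → ℝ := fun x => if 0 ≤ e m x then 1 else -1
  have hs : Measurable s :=
    Measurable.ite (measurableSet_le measurable_const (hem m)) measurable_const measurable_const
  have hs1 : ∀ x, ‖s x‖ ≤ 1 := fun x => by simp only [s]; split_ifs <;> simp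
  have hsL : MemLp s ∞ μ := memLp_top_of_bound hs.aestronglyMeasurable 1 (ae_of_all _ hs1)
  have hsn : ‖hsL.toLp s‖ ≤ K := Lp.norm_le_of_ae_bound zero_le_one (by
    filter_upwards [hsL.coeFn_toLp] with x hx
    rw [hx]; exact hs1 x)
  calc ∫ x, |e m x| ∂μ = T m (hsL.toLp s) := by
        rw [hT]
        refine integral_congr_ae ?_
        filter_upwards [hsL.coeFn_toLp] with x hx
        rw [hx]
        simp only [s]
        split_ifs with h
        · rw [abs_of_nonneg h, mul_one]
        · rw [abs_of_neg (not_le.1 h), mul_neg_one]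
    _ ≤ ‖T m (hsL.toLp s)‖ := Real.le_norm_self _
    _ ≤ ‖T m‖ * ‖hsL.toLp s‖ := (T m).le_opNorm _
    _ ≤ C * K := mul_le_mul (hC m) hsn (norm_nonneg _) hC0

theorem ofReal_integral_le_lintegral_ofReal {α : Type*} [MeasurableSpace α] {μ : Measure α}
    {f : α → ℝ} (hf : Integrable f μ) :
    ENNReal.ofReal (∫ x, f x ∂μ) ≤ ∫⁻ x, ENNReal.ofReal (f x) ∂μ := by
  calc ENNReal.ofReal (∫ x, f x ∂μ) ≤ ENNReal.ofReal (∫ x, max (f x) 0 ∂μ) :=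
        ENNReal.ofReal_le_ofReal (integral_mono hf hf.pos_part fun x => le_max_left _ _)
    _ = ∫⁻ x, ENNReal.ofReal (max (f x) 0) ∂μ :=
        ofReal_integral_eq_lintegral_ofReal hf.pos_part (ae_of_all _ fun x => le_max_right _ _)
    _ = _ := by simp

/-- Lower semicontinuity for integrands bounded below by `f m + b m * e m`, where `f m → f` and
`b m → b` almost everywhere and `e m` tends to zero weakly in `L¹`. -/
theorem lintegral_le_liminf_of_affine_minorant {α : Type*} [MeasurableSpace α] {μ : Measure α}
    [IsFiniteMeasure μ] {e : ℕ → α → ℝ} (hem : ∀ m, Measurable (e m))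
    (he : ∀ m, Integrable (e m) μ)
    (hweak : ∀ g : α → ℝ, Measurable g → (∃ C : ℝ, ∀ x, |g x| ≤ C) →
      Tendsto (fun m => ∫ x, e m x * g x ∂μ) atTop (nhds 0))
    {f b : ℕ → α → ℝ} {f₀ b₀ : α → ℝ} {φ : ℕ → α → ℝ}
    (hfm : ∀ m, Measurable (f m)) (hbm : ∀ m, Measurable (b m))
    (hf₀ : Measurable f₀) (hb₀ : Measurable b₀)
    (hf : ∀ᵐ x ∂μ, Tendsto (fun m => f m x) atTop (nhds (f₀ x)))
    (hb : ∀ᵐ x ∂μ, Tendsto (fun m => b m x) atTop (nhds (b₀ x)))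
    (hφ : ∀ m x, f m x + b m x * e m x ≤ φ m x) :
    ∫⁻ x, ENNReal.ofReal (f₀ x) ∂μ ≤
      liminf (fun m => ∫⁻ x, ENNReal.ofReal (φ m x) ∂μ) atTop := by
  obtain ⟨C, hC0, hC⟩ := exists_integral_abs_le_of_weakly_null hem he hweak
  set L := liminf (fun m => ∫⁻ x, ENNReal.ofReal (φ m x) ∂μ) atTop with hL
  have key : ∀ η : ℝ, 0 < η →
      ∫⁻ x, ENNReal.ofReal (f₀ x) ∂μ ≤ L + ENNReal.ofReal (η * (μ.real univ + C)) := by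
    intro η hη
    let S : ℕ → Set α := fun N => {x | |b₀ x| ≤ N ∧ 0 ≤ f₀ x ∧ f₀ x ≤ N ∧
      ∀ k, N ≤ k → |f k x - f₀ x| ≤ η ∧ |b k x - b₀ x| ≤ η}
    have hSm : ∀ N, MeasurableSet (S N) := by
      intro N
      refine (measurableSet_le hb₀.abs measurable_const).inter
        ((measurableSet_le measurable_const hf₀).inter
        ((measurableSet_le hf₀ measurable_const).inter ?_))
      refine MeasurableSet.congr (s := ⋂ k, ⋂ (_ : N ≤ k),
        {x | |f k x - f₀ x| ≤ η ∧ |b k x - b₀ x| ≤ η}) ?_ ?_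
      · exact MeasurableSet.iInter fun k => MeasurableSet.iInter fun _ =>
          (measurableSet_le ((hfm k).sub hf₀).abs measurable_const).inter
          (measurableSet_le ((hbm k).sub hb₀).abs measurable_const)
      · ext x; simp only [mem_iInter, mem_ofPred_eq]; rfl
    have hSmono : Monotone S := by
      intro M N hMN x hx
      have h : (M : ℝ) ≤ N := by exact_mod_cast hMN
      exact ⟨hx.1.trans h, hx.2.1, hx.2.2.1.trans h, fun k hk => hx.2.2.2 k (hMN.trans hk)⟩
    have hSU : ∀ᵐ x ∂μ, 0 ≤ f₀ x → x ∈ ⋃ N, S N := by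
      filter_upwards [hf, hb] with x hfx hbx h0
      obtain ⟨N₁, h₁⟩ := exists_nat_ge (|b₀ x|)
      obtain ⟨N₂, h₂⟩ := exists_nat_ge (f₀ x)
      obtain ⟨N₃, h₃⟩ := Metric.tendsto_atTop.1 hfx η hη
      obtain ⟨N₄, h₄⟩ := Metric.tendsto_atTop.1 hbx η hη
      refine mem_iUnion.2 ⟨max (max N₁ N₂) (max N₃ N₄), h₁.trans ?_, h0, h₂.trans ?_,
        fun k hk => ⟨(h₃ k ?_).le, (h₄ k ?_).le⟩⟩
      · exact_mod_cast (le_max_left _ _).trans (le_max_left _ _)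
      · exact_mod_cast (le_max_right _ _).trans (le_max_left _ _)
      · exact ((le_max_left _ _).trans (le_max_right _ _)).trans hk
      · exact ((le_max_right _ _).trans (le_max_right _ _)).trans hk
    have hN : ∀ N, ∫⁻ x in S N, ENNReal.ofReal (f₀ x) ∂μ ≤
        L + ENNReal.ofReal (η * (μ.real univ + C)) := by
      intro N
      have hfS : IntegrableOn f₀ (S N) μ := by
        refine Integrable.of_bound (C := N) hf₀.aestronglyMeasurable ?_
        filter_upwards [ae_restrict_mem (hSm N)] with x hx
        rw [Real.norm_eq_abs, abs_of_nonneg hx.2.1]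
        exact hx.2.2.1
      have hbe : ∀ m, IntegrableOn (fun x => e m x * b₀ x) (S N) μ := by
        intro m
        refine (he m).integrableOn.mul_bdd (c := N) hb₀.aestronglyMeasurable ?_
        filter_upwards [ae_restrict_mem (hSm N)] with x hx
        exact hx.1
      have hlim : Tendsto (fun m => ∫ x in S N, e m x * b₀ x ∂μ) atTop (nhds 0) := by
        refine (hweak ((S N).indicator b₀) (hb₀.indicator (hSm N)) ⟨N, fun x => ?_⟩).congr
          fun m => ?_
        · by_cases hx : x ∈ S N
          · rw [indicator_of_mem hx]; exact hx.1
          · rw [indicator_of_notMem hx]; simp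
        · rw [← integral_indicator (hSm N)]
          congr 1; ext x
          by_cases hx : x ∈ S N <;> simp [hx]
      have hstep : ∀ m, N ≤ m → ∫⁻ x in S N, ENNReal.ofReal (f₀ x) ∂μ ≤
          (∫⁻ x, ENNReal.ofReal (φ m x) ∂μ) + (ENNReal.ofReal (η * (μ.real univ + C)) +
          ENNReal.ofReal (-∫ x in S N, e m x * b₀ x ∂μ)) := by
        intro m hm
        have hi : IntegrableOn (fun x => η * (1 + |e m x|)) (S N) μ :=
          (((integrable_const _).add (he m).abs).const_mul η).integrableOn
        have hfb : IntegrableOn (fun x => f₀ x + e m x * b₀ x) (S N) μ := hfS.add (hbe m)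
        have hint : IntegrableOn (fun x => f₀ x + e m x * b₀ x - η * (1 + |e m x|)) (S N) μ :=
          hfb.sub hi
        have h1 : ∫ x in S N, η * (1 + |e m x|) ∂μ ≤ η * (μ.real univ + C) := by
          calc ∫ x in S N, η * (1 + |e m x|) ∂μ ≤ ∫ x, η * (1 + |e m x|) ∂μ :=
                setIntegral_le_integral (((integrable_const _).add (he m).abs).const_mul η)
                  (ae_of_all _ fun x => by positivity)
            _ = η * (μ.real univ + ∫ x, |e m x| ∂μ) := by
                rw [integral_const_mul, integral_add (integrable_const _) (he m).abs]
                simp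
            _ ≤ _ := by gcongr; exact hC m
        have h2 : ∫ x in S N, (f₀ x + e m x * b₀ x - η * (1 + |e m x|)) ∂μ =
            ∫ x in S N, f₀ x ∂μ + ∫ x in S N, e m x * b₀ x ∂μ
              - ∫ x in S N, η * (1 + |e m x|) ∂μ := by
          rw [integral_sub hfb hi, integral_add hfS (hbe m)]
        have h3 : ENNReal.ofReal (∫ x in S N, (f₀ x + e m x * b₀ x - η * (1 + |e m x|)) ∂μ) ≤
            ∫⁻ x, ENNReal.ofReal (φ m x) ∂μ := by
          refine (ofReal_integral_le_lintegral_ofReal hint).trans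
            ((setLIntegral_mono_ae' (hSm N) (ae_of_all _ fun x hx => ?_)).trans
              (setLIntegral_le_lintegral _ _))
          refine ENNReal.ofReal_le_ofReal (le_trans ?_ (hφ m x))
          obtain ⟨hx1, hx2⟩ := hx.2.2.2 m hm
          have h4 : |(b m x - b₀ x) * e m x| ≤ η * |e m x| := by
            rw [abs_mul]; gcongr
          linarith [(abs_le.1 hx1).1, (abs_le.1 h4).1]
        rw [← ofReal_integral_eq_lintegral_ofReal hfS (by
          filter_upwards [ae_restrict_mem (hSm N)] with x hx using hx.2.1)]
        calc ENNReal.ofReal (∫ x in S N, f₀ x ∂μ) ≤ ENNReal.ofReal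
              (∫ x in S N, (f₀ x + e m x * b₀ x - η * (1 + |e m x|)) ∂μ
                + (η * (μ.real univ + C) + -∫ x in S N, e m x * b₀ x ∂μ)) :=
              ENNReal.ofReal_le_ofReal (by linarith)
          _ ≤ _ := ENNReal.ofReal_add_le.trans (add_le_add h3 ENNReal.ofReal_add_le)
      have hlim' : Tendsto (fun m => ENNReal.ofReal (η * (μ.real univ + C)) +
          ENNReal.ofReal (-∫ x in S N, e m x * b₀ x ∂μ)) atTop
          (nhds (ENNReal.ofReal (η * (μ.real univ + C)))) := by
        simpa using (ENNReal.tendsto_ofReal hlim.neg).const_add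
          (ENNReal.ofReal (η * (μ.real univ + C)))
      refine ENNReal.le_of_forall_pos_le_add fun ε hε _ => ?_
      have hev : ∀ᶠ m in atTop, ENNReal.ofReal (η * (μ.real univ + C)) +
          ENNReal.ofReal (-∫ x in S N, e m x * b₀ x ∂μ) ≤
          ENNReal.ofReal (η * (μ.real univ + C)) + ε :=
        hlim'.eventually_le_const (ENNReal.lt_add_right ENNReal.ofReal_ne_top
          (by simpa using hε.ne'))
      rw [add_assoc, ← tsub_le_iff_right]
      refine le_liminf_of_le (by isBoundedDefault) ?_
      filter_upwards [hev, eventually_ge_atTop N] with m h1 h2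
      rw [tsub_le_iff_right]
      exact (hstep m h2).trans (by gcongr)
    calc ∫⁻ x, ENNReal.ofReal (f₀ x) ∂μ = ∫⁻ x in ⋃ N, S N, ENNReal.ofReal (f₀ x) ∂μ := by
          rw [← lintegral_indicator (MeasurableSet.iUnion hSm)]
          refine lintegral_congr_ae ?_
          filter_upwards [hSU] with x hx
          by_cases h : x ∈ ⋃ N, S N
          · rw [indicator_of_mem h]
          · rw [indicator_of_notMem h]
            exact ENNReal.ofReal_of_nonpos (not_le.1 fun h0 => h (hx h0)).le
      _ = ⨆ N, ∫⁻ x in S N, ENNReal.ofReal (f₀ x) ∂μ :=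
          setLIntegral_iUnion_of_directed _ hSmono.directed_le
      _ ≤ _ := iSup_le hN
  have hlim : Tendsto (fun η : ℝ => L + ENNReal.ofReal (η * (μ.real univ + C)))
      (nhdsWithin 0 (Ioi 0)) (nhds L) := by
    have : Tendsto (fun η : ℝ => η * (μ.real univ + C)) (nhds 0) (nhds 0) := by
      simpa using (tendsto_id (α := ℝ) (x := nhds 0)).mul_const (μ.real univ + C)
    simpa using ((ENNReal.tendsto_ofReal this).const_add L).mono_left nhdsWithin_le_nhds
  exact ge_of_tendsto hlim (by filter_upwards [self_mem_nhdsWithin] with η hη using key η hη)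

theorem ConvexOn.secant_minorant {F : ℝ → ℝ} (hc : ConvexOn ℝ (Ici 0) F)
    (hm : MonotoneOn F (Ici 0)) {p q h : ℝ} (hp : 0 ≤ p) (hq : 0 ≤ q) (hh : 0 < h) :
    F q - (F (q + h) - F q) + (F (q + h) - F q) / h * (p - q) ≤ F p := by
  have hqh : q + h ∈ Ici (0 : ℝ) := mem_Ici.2 (by linarith)
  set s := (F (q + h) - F q) / h with hs
  have hF : F (q + h) - F q = s * h := by rw [hs]; field_simp
  have hs0 : 0 ≤ s := div_nonneg (sub_nonneg.2 (hm hq hqh (by linarith))) hh.le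
  rw [hF]
  rcases lt_or_ge p q with hpq | hpq
  · have h1 := hc.slope_mono_adjacent hp hqh hpq (by linarith : q < q + h)
    rw [add_sub_cancel_left, ← hs, div_le_iff₀ (by linarith)] at h1
    nlinarith
  rcases le_or_gt p (q + h) with hph | hph
  · have h1 := hm hq hp hpq
    nlinarith
  · have h1 := hc.slope_mono_adjacent hq hp (by linarith : q < q + h) hph
    rw [add_sub_cancel_left, ← hs, le_div_iff₀ (by linarith)] at h1
    nlinarith

theorem lintegral_convex_le_liminf {α : Type*} [MeasurableSpace α] {μ : Measure α}
    [IsFiniteMeasure μ] {F : ℝ → ℝ → ℝ} (hF : Continuous fun p : ℝ × ℝ => F p.1 p.2)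
    (hconv : ∀ v, ConvexOn ℝ (Ici 0) (F v)) (hmono : ∀ v, MonotoneOn (F v) (Ici 0))
    {d : ℕ → α → ℝ} {w : α → ℝ} (hdm : ∀ m, Measurable (d m)) (hwm : Measurable w)
    (hd : ∀ m, Integrable (d m) μ) (hw : Integrable w μ)
    (hweak : ∀ g : α → ℝ, Measurable g → (∃ C : ℝ, ∀ x, |g x| ≤ C) →
      Tendsto (fun m => ∫ x, (d m x - w x) * g x ∂μ) atTop (nhds 0))
    {v A : ℕ → α → ℝ} {v₀ A₀ : α → ℝ}
    (hvm : ∀ m, Measurable (v m)) (hAm : ∀ m, Measurable (A m))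
    (hv₀ : Measurable v₀) (hA₀ : Measurable A₀)
    (hA : ∀ m x, 0 ≤ A m x)
    (hvlim : ∀ᵐ x ∂μ, Tendsto (fun m => v m x) atTop (nhds (v₀ x)))
    (hAlim : ∀ᵐ x ∂μ, Tendsto (fun m => A m x) atTop (nhds (A₀ x))) :
    ∫⁻ x, ENNReal.ofReal (F (v₀ x) (A₀ x * |w x|)) ∂μ ≤
      liminf (fun m => ∫⁻ x, ENNReal.ofReal (F (v m x) (A m x * |d m x|)) ∂μ) atTop := by
  let σ : α → ℝ := fun x => if 0 ≤ w x then 1 else -1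
  have hσm : Measurable σ :=
    Measurable.ite (measurableSet_le measurable_const hwm) measurable_const measurable_const
  have hσ : ∀ x t, σ x * (t - w x) ≤ |t| - |w x| := by
    intro x t
    simp only [σ]
    split_ifs with h
    · rw [abs_of_nonneg h]; linarith [le_abs_self t]
    · rw [abs_of_neg (not_le.1 h)]; linarith [neg_le_abs t]
  let G : ℝ → ℝ → ℝ → ℝ := fun h y q => F y q - (F y (q + h) - F y q)
  let B : ℝ → ℝ → ℝ → ℝ := fun h y q => (F y (q + h) - F y q) / h
  have hFh : ∀ h : ℝ, Continuous fun p : ℝ × ℝ => F p.1 (p.2 + h) := fun h =>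
    hF.comp (continuous_fst.prodMk (continuous_snd.add continuous_const))
  have hG : ∀ h, Continuous fun p : ℝ × ℝ => G h p.1 p.2 := fun h => hF.sub ((hFh h).sub hF)
  have hB : ∀ h, Continuous fun p : ℝ × ℝ => B h p.1 p.2 := fun h => ((hFh h).sub hF).div_const h
  have hqm : ∀ m, Measurable fun x => (v m x, A m x * |w x|) := fun m =>
    (hvm m).prodMk ((hAm m).mul hwm.abs)
  have hq₀ : Measurable fun x => (v₀ x, A₀ x * |w x|) := hv₀.prodMk (hA₀.mul hwm.abs)
  have hqlim : ∀ᵐ x ∂μ, Tendsto (fun m => (v m x, A m x * |w x|)) atTop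
      (nhds (v₀ x, A₀ x * |w x|)) := by
    filter_upwards [hvlim, hAlim] with x h1 h2
    exact h1.prodMk_nhds (h2.mul_const _)
  have key : ∀ h : ℝ, 0 < h → ∫⁻ x, ENNReal.ofReal (G h (v₀ x) (A₀ x * |w x|)) ∂μ ≤
      liminf (fun m => ∫⁻ x, ENNReal.ofReal (F (v m x) (A m x * |d m x|)) ∂μ) atTop := by
    intro h hh
    refine lintegral_le_liminf_of_affine_minorant (e := fun m x => d m x - w x)
      (f := fun m x => G h (v m x) (A m x * |w x|))
      (b := fun m x => B h (v m x) (A m x * |w x|) * A m x * σ x)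
      (b₀ := fun x => B h (v₀ x) (A₀ x * |w x|) * A₀ x * σ x)
      (fun m => (hdm m).sub hwm) (fun m => (hd m).sub hw) hweak
      (fun m => (hG h).measurable.comp (hqm m))
      (fun m => (((hB h).measurable.comp (hqm m)).mul (hAm m)).mul hσm)
      ((hG h).measurable.comp hq₀) ((((hB h).measurable.comp hq₀).mul hA₀).mul hσm)
      ?_ ?_ ?_
    · filter_upwards [hqlim] with x hx
      exact ((hG h).tendsto _).comp hx
    · filter_upwards [hqlim, hAlim] with x hx hx'
      exact ((((hB h).tendsto _).comp hx).mul hx').mul_const _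
    · intro m x
      have hq : 0 ≤ A m x * |w x| := mul_nonneg (hA m x) (abs_nonneg _)
      have h1 := (hconv (v m x)).secant_minorant (hmono (v m x))
        (mul_nonneg (hA m x) (abs_nonneg (d m x))) hq hh
      have hB0 : 0 ≤ B h (v m x) (A m x * |w x|) :=
        div_nonneg (sub_nonneg.2 (hmono _ hq (mem_Ici.2 (by linarith)) (by linarith))) hh.le
      have h2 := mul_le_mul_of_nonneg_left (hσ x (d m x)) (mul_nonneg hB0 (hA m x))
      refine le_trans ?_ h1
      change G h (v m x) (A m x * |w x|) + _ ≤ G h (v m x) (A m x * |w x|) +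
        B h (v m x) (A m x * |w x|) * _
      linarith
  have hlim : ∀ x, Tendsto (fun n : ℕ => ENNReal.ofReal
      (G (1 / ((n : ℝ) + 1)) (v₀ x) (A₀ x * |w x|))) atTop
      (nhds (ENNReal.ofReal (F (v₀ x) (A₀ x * |w x|)))) := by
    intro x
    refine ENNReal.tendsto_ofReal ?_
    have hc : Continuous fun h => G h (v₀ x) (A₀ x * |w x|) :=
      continuous_const.sub ((hF.comp (continuous_const.prodMk
        (continuous_const.add continuous_id))).sub continuous_const)
    have := (hc.tendsto 0).comp (tendsto_one_div_add_atTop_nhds_zero_nat (𝕜 := ℝ))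
    simpa [G, Function.comp_def] using this
  calc ∫⁻ x, ENNReal.ofReal (F (v₀ x) (A₀ x * |w x|)) ∂μ
      = ∫⁻ x, liminf (fun n : ℕ => ENNReal.ofReal
          (G (1 / ((n : ℝ) + 1)) (v₀ x) (A₀ x * |w x|))) atTop ∂μ :=
        lintegral_congr fun x => (hlim x).liminf_eq.symm
    _ ≤ liminf (fun n : ℕ => ∫⁻ x, ENNReal.ofReal
          (G (1 / ((n : ℝ) + 1)) (v₀ x) (A₀ x * |w x|)) ∂μ) atTop :=
        lintegral_liminf_le fun n => ((hG _).measurable.comp hq₀).ennreal_ofReal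
    _ ≤ _ := liminf_le_of_le (by isBoundedDefault) fun c hc => by
        obtain ⟨n, hn⟩ := hc.exists
        exact hn.trans (key _ (by positivity))

theorem MemW11.continuousOn {u : ℝ → ℝ} (hu : MemW11 u) : ContinuousOn u (Icc (-1) 1) := by
  have h : ContinuousOn (fun x => u (-1) + ∫ t in (-1 : ℝ)..x, deriv u t) (Icc (-1) 1) := by
    refine continuousOn_const.add ?_
    have := intervalIntegral.continuousOn_primitive_interval (a := (-1 : ℝ)) (b := 1)
      (f := deriv u) (μ := volume) (by rw [uIcc_of_le (by norm_num)]; exact hu.1)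
    rwa [uIcc_of_le (by norm_num)] at this
  exact h.congr hu.2

/-- Weak convergence in `W¹₁(-1,1)` implies pointwise convergence. -/
theorem tendsto_apply_of_weakly_tendsto {u : ℕ → ℝ → ℝ} {u₀ : ℝ → ℝ}
    (hu : ∀ m, MemW11 (u m)) (hu₀ : MemW11 u₀)
    (hweak : ∀ g : ℝ → ℝ, Measurable g → (∃ C : ℝ, ∀ x, |g x| ≤ C) →
      Tendsto (fun m => ∫ x in Icc (-1 : ℝ) 1, (u m x - u₀ x) * g x) atTop (nhds 0) ∧
      Tendsto (fun m => ∫ x in Icc (-1 : ℝ) 1, (deriv (u m) x - deriv u₀ x) * g x)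
        atTop (nhds 0)) {x : ℝ} (hx : x ∈ Icc (-1 : ℝ) 1) :
    Tendsto (fun m => u m x) atTop (nhds (u₀ x)) := by
  let e : ℕ → ℝ → ℝ := fun m t => deriv (u m) t - deriv u₀ t
  have hem : ∀ m, Measurable (e m) := fun m => (measurable_deriv _).sub (measurable_deriv _)
  have he : ∀ m, IntegrableOn (e m) (Icc (-1) 1) := fun m => (hu m).1.sub hu₀.1
  obtain ⟨C, hC0, hC⟩ := exists_integral_abs_le_of_weakly_null hem he
    fun g hg hb => (hweak g hg hb).2
  let P : ℕ → ℝ → ℝ := fun m y => ∫ t in (-1 : ℝ)..y, e m t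
  have hsub : ∀ y ∈ Icc (-1 : ℝ) 1, Ioc (-1) y ⊆ Icc (-1 : ℝ) 1 := fun y hy t ht =>
    ⟨ht.1.le, ht.2.trans hy.2⟩
  have hPlim : ∀ y ∈ Icc (-1 : ℝ) 1, Tendsto (fun m => P m y) atTop (nhds 0) := by
    intro y hy
    refine ((hweak ((Ioc (-1) y).indicator 1) (measurable_one.indicator measurableSet_Ioc)
      ⟨1, fun t => ?_⟩).2).congr fun m => ?_
    · by_cases ht : t ∈ Ioc (-1) y <;> simp [ht]
    · simp only [P]
      rw [intervalIntegral.integral_of_le hy.1, ← inter_eq_right.2 (hsub y hy),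
        ← setIntegral_indicator measurableSet_Ioc, inter_eq_right.2 (hsub y hy)]
      congr 1; ext t
      by_cases ht : t ∈ Ioc (-1) y <;> simp [ht, e]
  have hPb : ∀ m, ∀ y ∈ Icc (-1 : ℝ) 1, ‖P m y‖ ≤ C := by
    intro m y hy
    refine (intervalIntegral.norm_integral_le_integral_norm hy.1).trans ?_
    rw [intervalIntegral.integral_of_le hy.1]
    exact (setIntegral_mono_set (he m).norm (ae_of_all _ fun t => norm_nonneg _)
      (hsub y hy).eventuallyLE).trans (hC m)
  have hPc : ∀ m, ContinuousOn (P m) (Icc (-1) 1) := by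
    intro m
    have := intervalIntegral.continuousOn_primitive_interval (a := (-1 : ℝ)) (b := 1)
      (f := e m) (μ := volume) (by rw [uIcc_of_le (by norm_num)]; exact he m)
    rwa [uIcc_of_le (by norm_num)] at this
  have hPint : Tendsto (fun m => ∫ y in Icc (-1 : ℝ) 1, P m y) atTop (nhds 0) := by
    have := tendsto_integral_of_dominated_convergence (μ := volume.restrict (Icc (-1 : ℝ) 1))
      (F := P) (f := fun _ => (0 : ℝ)) (fun _ => C)
      (fun m => (hPc m).aestronglyMeasurable measurableSet_Icc) (integrable_const _)
      (fun m => (ae_restrict_mem measurableSet_Icc).mono (hPb m))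
      ((ae_restrict_mem measurableSet_Icc).mono hPlim)
    simpa using this
  have hdiff : ∀ m, ∀ y ∈ Icc (-1 : ℝ) 1, u m y - u₀ y = (u m (-1) - u₀ (-1)) + P m y := by
    intro m y hy
    have hi : ∀ {w : ℝ → ℝ}, MemW11 w → IntervalIntegrable (deriv w) volume (-1) y := fun hw =>
      (intervalIntegrable_iff_integrableOn_Ioc_of_le hy.1).2 (hw.1.mono_set (hsub y hy))
    simp only [P, e]
    rw [intervalIntegral.integral_sub (hi (hu m)) (hi hu₀), (hu m).2 y hy, hu₀.2 y hy]
    ring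
  have hleft : Tendsto (fun m => u m (-1) - u₀ (-1)) atTop (nhds 0) := by
    have h1 := (hweak (fun _ => 1) measurable_const ⟨1, by simp⟩).1
    have h2 := (h1.sub hPint).div_const 2
    simp only [sub_zero, zero_div] at h2
    refine h2.congr fun m => ?_
    have h3 : ∫ y in Icc (-1 : ℝ) 1, (u m y - u₀ y) * 1 =
        ∫ y in Icc (-1 : ℝ) 1, ((u m (-1) - u₀ (-1)) + P m y) :=
      setIntegral_congr_fun measurableSet_Icc fun y hy => by
        simp only [mul_one]; exact hdiff m y hy
    rw [h3, integral_add (integrable_const _) ((hPc m).integrableOn_compact isCompact_Icc)]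
    simp
    ring
  have h := (hleft.add (hPlim x hx)).add_const (u₀ x)
  simp only [add_zero, zero_add] at h
  exact h.congr fun m => by rw [← hdiff m x hx]; ring

/-- the functional `I(a,·)` is weakly lower semicontinuous on nonnegative
functions in `W¹₁(-1,1)`. -/
theorem stmt9 (a F : ℝ → ℝ → ℝ) (ha : Weight a) (hF : MemFrakF F)
    (u : ℕ → ℝ → ℝ) (u₀ : ℝ → ℝ)
    (hu : ∀ m, MemW11 (u m)) (hu₀ : MemW11 u₀)
    (hnn : ∀ m, ∀ x ∈ Icc (-1 : ℝ) 1, 0 ≤ u m x)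
    (hnn₀ : ∀ x ∈ Icc (-1 : ℝ) 1, 0 ≤ u₀ x)
    (hweak : ∀ g : ℝ → ℝ, Measurable g → (∃ C : ℝ, ∀ x, |g x| ≤ C) →
      Tendsto (fun m => ∫ x in Icc (-1 : ℝ) 1, (u m x - u₀ x) * g x) atTop (nhds 0) ∧
      Tendsto (fun m => ∫ x in Icc (-1 : ℝ) 1, (deriv (u m) x - deriv u₀ x) * g x)
        atTop (nhds 0)) :
    Ifun F a u₀ ≤ Filter.liminf (fun m => Ifun F a (u m)) atTop := by
  let π : ℝ → ℝ := fun x => max (-1) (min 1 x)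
  have hπc : Continuous π := continuous_const.max (continuous_const.min continuous_id)
  have hπ : ∀ x, π x ∈ Icc (-1 : ℝ) 1 := fun x =>
    ⟨le_max_left _ _, max_le (by norm_num) (min_le_left _ _)⟩
  have hπid : ∀ x ∈ Icc (-1 : ℝ) 1, π x = x := fun x hx => by
    simp only [π]; rw [min_eq_right hx.2, max_eq_right hx.1]
  let E : ℝ → ℝ → ℝ := fun v p => F (max v 0) (max p 0)
  have hE : ∀ {v p}, 0 ≤ v → 0 ≤ p → E v p = F v p := fun hv hp => by
    simp only [E]; rw [max_eq_left hv, max_eq_left hp]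
  have hEc : Continuous fun p : ℝ × ℝ => E p.1 p.2 :=
    hF.1.comp_continuous (f := fun p : ℝ × ℝ => (max p.1 0, max p.2 0))
      ((continuous_fst.max continuous_const).prodMk (continuous_snd.max continuous_const))
      fun p => ⟨mem_Ici.2 (le_max_right _ _), mem_Ici.2 (le_max_right _ _)⟩
  have hEF : ∀ v, EqOn (F (max v 0)) (E v) (Ici 0) := fun v p hp => by
    simp only [E]; rw [max_eq_left (mem_Ici.1 hp)]
  have huc : ∀ {w : ℝ → ℝ}, MemW11 w → Continuous fun x => w (π x) := fun hw =>
    hw.continuousOn.comp_continuous hπc hπ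
  have hac : ∀ {w : ℝ → ℝ}, MemW11 w → (∀ x ∈ Icc (-1 : ℝ) 1, 0 ≤ w x) →
      Continuous fun x => a (π x) (w (π x)) := fun hw hw0 =>
    ha.1.comp_continuous (hπc.prodMk (huc hw)) fun x => ⟨hπ x, hw0 _ (hπ x)⟩
  have hI : ∀ {w : ℝ → ℝ}, (∀ x ∈ Icc (-1 : ℝ) 1, 0 ≤ w x) → Ifun F a w =
      ∫⁻ x in Icc (-1 : ℝ) 1, ENNReal.ofReal (E (w (π x)) (a (π x) (w (π x)) * |deriv w x|)) := by
    intro w hw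
    refine setLIntegral_congr_fun measurableSet_Icc fun x hx => ?_
    simp only [hπid x hx]
    rw [hE (hw x hx) (mul_nonneg (ha.2 x _ hx (hw x hx)) (abs_nonneg _))]
  have hlim : ∀ x, Tendsto (fun m => u m (π x)) atTop (nhds (u₀ (π x))) := fun x =>
    tendsto_apply_of_weakly_tendsto hu hu₀ hweak (hπ x)
  rw [hI hnn₀, funext fun m => hI (hnn m)]
  refine lintegral_convex_le_liminf hEc
    (fun v => (hF.2.2.1 _ (le_max_right _ _)).congr (hEF v))
    (fun v => (hF.2.2.2 _ (le_max_right _ _)).congr (hEF v))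
    (fun m => measurable_deriv _) (measurable_deriv _) (fun m => (hu m).1) hu₀.1
    (fun g hg hb => (hweak g hg hb).2) (fun m => (huc (hu m)).measurable)
    (fun m => (hac (hu m) (hnn m)).measurable) (huc hu₀).measurable (hac hu₀ hnn₀).measurable
    (fun m x => ha.2 _ _ (hπ x) (hnn m _ (hπ x))) (ae_of_all _ hlim) (ae_of_all _ fun x => ?_)
  have h := (ha.1 (π x, u₀ (π x)) ⟨hπ x, hnn₀ _ (hπ x)⟩)
  exact h.tendsto.comp (tendsto_nhdsWithin_iff.2 ⟨tendsto_const_nhds.prodMk_nhds (hlim x),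
    Eventually.of_forall fun m => ⟨hπ x, hnn m _ (hπ x)⟩⟩)
end
end
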